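/- arXiv:1101.1237 — 7 statements merged into one kernel-verified Lean document; each statement's English description precedes it below -/
import Mathlib

section
/- Consider two nodes in tandem: A_1 is the arrival process to node 1 with departure process D_1, and node 2 has arrival process A_2 := D_1 and departure process D_2. Suppose node h (h = 1, 2) offers a statistical service curve S_h(t; σ) with bounding function ε_h(σ), where each S_h(t; σ) is nondecreasing in t and nonincreasing in σ, and ε_1 is nonincreasing. Let γ_1, τ_1 > 0 and σ_1, σ_2 ≥ 0. Then for every t ≥ 0: ℙ( D_2(t) < inf { A_1(s) + S_1(x_1; σ_1 + γ_1(τ_1 + x_2)) + S_2(x_2; σ_2) : s, x_1, x_2 ≥ 0 and s + x_1 + x_2 + τ_1 ≤ t } ) ≤ ε_2(σ_2) + (1/(γ_1 τ_1)) ∫_{σ_1}^∞ ε_1(y) dy. -/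
open MeasureTheory Set

/-- Riemann-sum bound: right-endpoint sums of an antitone function lie below its integral. -/
theorem sum_right_endpoints_mul_le_setLIntegral {f : ℝ → ENNReal} {a c : ℝ} (hc : 0 ≤ c)
    (hf : AntitoneOn f (Ici a)) (n : ℕ) :
    (∑ k ∈ Finset.range n, f (a + c * (k + 1))) * ENNReal.ofReal c
      ≤ ∫⁻ y in Ico a (a + c * n), f y := by
  induction n with
  | zero => simp
  | succ n ih =>
    have hn : 0 ≤ c * n := by positivity
    have hsplit : Ico a (a + c * (n + 1 : ℕ))
        = Ico a (a + c * n) ∪ Ico (a + c * n) (a + c * (n + 1 : ℕ)) := by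
      rw [Ico_union_Ico_eq_Ico] <;> push_cast <;> nlinarith
    rw [hsplit, lintegral_union measurableSet_Ico
      (Set.disjoint_left.2 fun x hx hx' => absurd hx.2 (not_lt.2 hx'.1)),
      Finset.sum_range_succ, add_mul]
    refine add_le_add ih ?_
    have hlen : volume (Ico (a + c * n) (a + c * (n + 1 : ℕ))) = ENNReal.ofReal c := by
      rw [Real.volume_Ico]
      congr 1
      push_cast
      ring
    rw [← hlen, ← setLIntegral_const]
    refine setLIntegral_mono' measurableSet_Ico fun y hy => ?_
    have hy2 := hy.2
    push_cast at hy2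
    exact hf (mem_Ici.2 (by linarith [hy.1])) (mem_Ici.2 (by linarith [hy.1])) hy2.le

theorem sum_right_endpoints_le_mul_setLIntegral_Ici {f : ℝ → ENNReal} {a c : ℝ} (hc : 0 < c)
    (hf : AntitoneOn f (Ici a)) (n : ℕ) :
    ∑ k ∈ Finset.range n, f (a + c * (k + 1))
      ≤ ENNReal.ofReal (1 / c) * ∫⁻ y in Ici a, f y := by
  have hinv : ENNReal.ofReal (1 / c) * ENNReal.ofReal c = 1 := by
    rw [← ENNReal.ofReal_mul (by positivity), one_div_mul_cancel hc.ne', ENNReal.ofReal_one]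
  calc ∑ k ∈ Finset.range n, f (a + c * (k + 1))
      = ENNReal.ofReal (1 / c) *
          ((∑ k ∈ Finset.range n, f (a + c * (k + 1))) * ENNReal.ofReal c) := by
        rw [mul_comm (∑ k ∈ Finset.range n, f (a + c * (k + 1))), ← mul_assoc, hinv, one_mul]
    _ ≤ ENNReal.ofReal (1 / c) * ∫⁻ y in Ici a, f y := by
        gcongr
        exact (sum_right_endpoints_mul_le_setLIntegral hc.le hf n).trans
          (lintegral_mono_set Ico_subset_Ici_self)

/-- Two-node case of the network service curve theorem (Theorem 1, Eq. (9)). -/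
theorem two_node_network_service_curve
    {Ω : Type*} [MeasurableSpace Ω] (P : Measure Ω) [IsProbabilityMeasure P]
    (A1 D1 D2 : Ω → ℝ → ℝ)
    (hA1_zero : ∀ ω, A1 ω 0 = 0) (hD1_zero : ∀ ω, D1 ω 0 = 0) (hD2_zero : ∀ ω, D2 ω 0 = 0)
    (hA1_mono : ∀ ω s t, 0 ≤ s → s ≤ t → A1 ω s ≤ A1 ω t)
    (hD1_mono : ∀ ω s t, 0 ≤ s → s ≤ t → D1 ω s ≤ D1 ω t)
    (hD2_mono : ∀ ω s t, 0 ≤ s → s ≤ t → D2 ω s ≤ D2 ω t)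
    (hA1_nonneg : ∀ ω t, 0 ≤ t → 0 ≤ A1 ω t)
    (hD1_le : ∀ ω t, 0 ≤ t → D1 ω t ≤ A1 ω t)
    (hD2_le : ∀ ω t, 0 ≤ t → D2 ω t ≤ D1 ω t)
    (S1 S2 : ℝ → ℝ → ℝ) (ε1 ε2 : ℝ → ℝ)
    (hS1_mono_t : ∀ σ s t, 0 ≤ s → s ≤ t → S1 s σ ≤ S1 t σ)
    (hS2_mono_t : ∀ σ s t, 0 ≤ s → s ≤ t → S2 s σ ≤ S2 t σ)
    (hS1_anti : ∀ t σ σ', 0 ≤ σ → σ ≤ σ' → S1 t σ' ≤ S1 t σ)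
    (hS2_anti : ∀ t σ σ', 0 ≤ σ → σ ≤ σ' → S2 t σ' ≤ S2 t σ)
    (hε1_anti : ∀ σ σ', 0 ≤ σ → σ ≤ σ' → ε1 σ' ≤ ε1 σ)
    (hS1 : ∀ t σ, 0 ≤ t → 0 ≤ σ →
      P {ω | D1 ω t < ⨅ s : Icc (0:ℝ) t, (A1 ω ↑s + S1 (t - ↑s) σ)} ≤ ENNReal.ofReal (ε1 σ))
    (hS2 : ∀ t σ, 0 ≤ t → 0 ≤ σ →
      P {ω | D2 ω t < ⨅ s : Icc (0:ℝ) t, (D1 ω ↑s + S2 (t - ↑s) σ)} ≤ ENNReal.ofReal (ε2 σ))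
    (γ1 τ1 : ℝ) (hγ1 : 0 < γ1) (hτ1 : 0 < τ1)
    (σ1 σ2 : ℝ) (hσ1 : 0 ≤ σ1) (hσ2 : 0 ≤ σ2)
    (t : ℝ) (ht : 0 ≤ t) :
    P {ω | D2 ω t < sInf {v : ℝ | ∃ s x1 x2 : ℝ, 0 ≤ s ∧ 0 ≤ x1 ∧ 0 ≤ x2 ∧
        s + x1 + x2 + τ1 ≤ t ∧
        v = A1 ω s + S1 x1 (σ1 + γ1 * (τ1 + x2)) + S2 x2 σ2}}
      ≤ ENNReal.ofReal (ε2 σ2) +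
        ENNReal.ofReal (1 / (γ1 * τ1)) * ∫⁻ y in Ici σ1, ENNReal.ofReal (ε1 y) := by
  have hc : 0 < γ1 * τ1 := mul_pos hγ1 hτ1
  have hanti : AntitoneOn (fun y => ENNReal.ofReal (ε1 y)) (Ici σ1) := fun x hx y _ hxy =>
    ENNReal.ofReal_le_ofReal (hε1_anti x y (hσ1.trans hx) hxy)
  have hsum := sum_right_endpoints_le_mul_setLIntegral_Ici hc hanti
  have hD1_nonneg : ∀ ω s, 0 ≤ s → 0 ≤ D1 ω s := fun ω s hs =>
    (hD1_zero ω).symm.le.trans (hD1_mono ω 0 s le_rfl hs)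
  rcases lt_or_ge t τ1 with htτ | htτ
  · -- the infimum is over the empty set
    have hev : {ω | D2 ω t < sInf {v : ℝ | ∃ s x1 x2 : ℝ, 0 ≤ s ∧ 0 ≤ x1 ∧ 0 ≤ x2 ∧
        s + x1 + x2 + τ1 ≤ t ∧
        v = A1 ω s + S1 x1 (σ1 + γ1 * (τ1 + x2)) + S2 x2 σ2}} = ∅ := by
      ext ω
      have hemp : {v : ℝ | ∃ s x1 x2 : ℝ, 0 ≤ s ∧ 0 ≤ x1 ∧ 0 ≤ x2 ∧
          s + x1 + x2 + τ1 ≤ t ∧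
          v = A1 ω s + S1 x1 (σ1 + γ1 * (τ1 + x2)) + S2 x2 σ2} = ∅ := by
        ext v
        simp only [mem_ofPred_eq, mem_empty_iff_false, iff_false]
        rintro ⟨s, x1, x2, hs, hx1, hx2, hle, -⟩
        linarith
      simp only [mem_ofPred_eq, hemp, Real.sInf_empty, mem_empty_iff_false, iff_false, not_lt]
      exact (hD2_zero ω).symm.le.trans (hD2_mono ω 0 t le_rfl ht)
    rw [hev, measure_empty]
    exact zero_le
  have hσt : 0 ≤ σ1 + γ1 * t := by positivity
  rcases lt_or_ge 0 (S1 0 (σ1 + γ1 * t)) with hpos | hS1_zero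
  · -- at time `0` node 1 violates its service curve surely, so the bound is at least `1`
    have hone : 1 ≤ ENNReal.ofReal (ε1 (σ1 + γ1 * t)) := by
      refine le_trans (le_of_eq ?_) (hS1 0 (σ1 + γ1 * t) le_rfl hσt)
      rw [← measure_univ (μ := P)]
      congr 1
      symm
      refine eq_univ_of_forall fun ω => ?_
      have : Nonempty (Icc (0 : ℝ) 0) := ⟨⟨0, by simp⟩⟩
      have hinf : S1 0 (σ1 + γ1 * t)
          ≤ ⨅ s : Icc (0 : ℝ) 0, (A1 ω ↑s + S1 (0 - ↑s) (σ1 + γ1 * t)) := by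
        refine le_ciInf fun s => ?_
        have hs0 : (s : ℝ) = 0 := le_antisymm s.2.2 s.2.1
        simp [hs0, hA1_zero]
      simp only [mem_ofPred_eq, hD1_zero]
      exact hpos.trans_le hinf
    calc P _ ≤ 1 := prob_le_one
      _ ≤ ENNReal.ofReal (ε1 (σ1 + γ1 * t)) := hone
      _ ≤ ENNReal.ofReal (ε1 (σ1 + γ1 * τ1)) := by
          refine ENNReal.ofReal_le_ofReal (hε1_anti _ _ (by positivity) ?_)
          gcongr
      _ ≤ ENNReal.ofReal (1 / (γ1 * τ1)) * ∫⁻ y in Ici σ1, ENNReal.ofReal (ε1 y) := by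
          simpa using hsum 1
      _ ≤ _ := le_add_self
  set N : ℕ := ⌊t / τ1⌋₊
  have hNt : (N : ℝ) * τ1 ≤ t := by
    rw [← le_div_iff₀ hτ1]
    exact Nat.floor_le (by positivity)
  have hNlt : t < (N + 1) * τ1 := by
    rw [← div_lt_iff₀ hτ1]
    exact Nat.lt_floor_add_one _
  have hgrid : ∀ k ∈ Finset.range N, 0 ≤ t - (k + 1) * τ1 := by
    intro k hk
    have hk' : ((k + 1 : ℕ) : ℝ) ≤ N := by exact_mod_cast Finset.mem_range.1 hk
    push_cast at hk'
    nlinarith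
  have hsub : {ω | D2 ω t < sInf {v : ℝ | ∃ s x1 x2 : ℝ, 0 ≤ s ∧ 0 ≤ x1 ∧ 0 ≤ x2 ∧
        s + x1 + x2 + τ1 ≤ t ∧
        v = A1 ω s + S1 x1 (σ1 + γ1 * (τ1 + x2)) + S2 x2 σ2}}
      ⊆ {ω | D2 ω t < ⨅ s : Icc (0 : ℝ) t, (D1 ω ↑s + S2 (t - ↑s) σ2)} ∪
        ⋃ k ∈ Finset.range N, {ω | D1 ω (t - (k + 1) * τ1) <
          ⨅ s : Icc (0 : ℝ) (t - (k + 1) * τ1),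
            (A1 ω ↑s + S1 (t - (k + 1) * τ1 - ↑s) (σ1 + γ1 * τ1 * (k + 1)))} := by
    intro ω hω
    by_contra hnot
    simp only [mem_union, mem_iUnion, mem_ofPred_eq, not_or, not_exists, not_lt] at hnot
    obtain ⟨hgood2, hgood1⟩ := hnot
    rw [mem_ofPred_eq] at hω
    set V := {v : ℝ | ∃ s x1 x2 : ℝ, 0 ≤ s ∧ 0 ≤ x1 ∧ 0 ≤ x2 ∧
        s + x1 + x2 + τ1 ≤ t ∧
        v = A1 ω s + S1 x1 (σ1 + γ1 * (τ1 + x2)) + S2 x2 σ2}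
    have hbdd : BddBelow V := by
      refine ⟨S1 0 (σ1 + γ1 * (τ1 + t)) + S2 0 σ2, ?_⟩
      rintro v ⟨s, x1, x2, hs, hx1, hx2, hle, rfl⟩
      have h1 : S1 0 (σ1 + γ1 * (τ1 + t)) ≤ S1 0 (σ1 + γ1 * (τ1 + x2)) := by
        refine hS1_anti _ _ _ (by positivity) ?_
        gcongr
        linarith
      linarith [hA1_nonneg ω s hs, hS1_mono_t (σ1 + γ1 * (τ1 + x2)) 0 x1 le_rfl hx1,
        hS2_mono_t σ2 0 x2 le_rfl hx2]
    have : Nonempty (Icc (0 : ℝ) t) := ⟨⟨0, le_rfl, ht⟩⟩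
    refine absurd hω (not_lt.2 (le_trans (le_ciInf fun s => ?_) hgood2))
    obtain ⟨s, hs0, hst⟩ := s
    change sInf V ≤ D1 ω s + S2 (t - s) σ2
    set k : ℕ := ⌊(t - s) / τ1⌋₊
    have hkle : (k : ℝ) * τ1 ≤ t - s := by
      rw [← le_div_iff₀ hτ1]
      exact Nat.floor_le (div_nonneg (by linarith) hτ1.le)
    have hklt : t - s < (k + 1) * τ1 := by
      rw [← div_lt_iff₀ hτ1]
      exact Nat.lt_floor_add_one _
    have hS2k := hS2_mono_t σ2 (k * τ1) (t - s) (by positivity) hkle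
    by_cases hkN : k ∈ Finset.range N
    · have hr := hgrid k hkN
      have : Nonempty (Icc (0 : ℝ) (t - (k + 1) * τ1)) := ⟨⟨0, le_rfl, hr⟩⟩
      have h1 : sInf V - S2 (k * τ1) σ2 ≤ D1 ω (t - (k + 1) * τ1) := by
        refine le_trans (le_ciInf fun u => ?_) (hgood1 k hkN)
        obtain ⟨u, hu0, hur⟩ := u
        rw [sub_le_iff_le_add]
        refine csInf_le hbdd ⟨u, t - (k + 1) * τ1 - u, k * τ1, hu0, by linarith,
          by positivity, by linarith, ?_⟩
        have hσ : σ1 + γ1 * (τ1 + k * τ1) = σ1 + γ1 * τ1 * (k + 1) := by ring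
        rw [hσ]
      have h2 := hD1_mono ω (t - (k + 1) * τ1) s hr (by linarith)
      linarith
    · have hNk : (N : ℝ) ≤ k := by exact_mod_cast not_lt.1 (fun h => hkN (Finset.mem_range.2 h))
      have hsτ : s ≤ τ1 := by nlinarith
      have hmem : sInf V ≤ A1 ω 0 + S1 0 (σ1 + γ1 * (τ1 + (t - τ1))) + S2 (t - τ1) σ2 :=
        csInf_le hbdd ⟨0, 0, t - τ1, le_rfl, le_rfl, by linarith, by linarith, rfl⟩
      rw [hA1_zero, add_sub_cancel] at hmem
      linarith [hD1_nonneg ω s hs0,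
        hS2_mono_t σ2 (t - τ1) (t - s) (by linarith) (by linarith)]
  refine (measure_mono hsub).trans ((measure_union_le _ _).trans ?_)
  refine add_le_add (hS2 t σ2 ht hσ2) ?_
  refine (measure_biUnion_finset_le _ _).trans ((Finset.sum_le_sum fun k hk => ?_).trans (hsum N))
  exact hS1 _ _ (hgrid k hk) (by positivity)
end

section
/- (Intermediate form of the network service curve, Eq. (10).) Consider a flow passing through a tandem of H nodes: A_1 is the arrival process to node 1, D_h is the departure process of node h, and A_{h+1} := D_h. Assume node h offers a statistical service curve S_h(t; σ) with bounding function ε_h(σ), where each S_h(t; σ) is nondecreasing in t and nonincreasing in σ, each ε_h is nonincreasing, and ∫_0^∞ ε_h(y) dy < ∞ for h < H. Let τ_1, …, τ_{H−1} and γ_1, …, γ_{H−1} be positive and σ_1, …, σ_H ≥ 0. Then for every t ≥ 0: ℙ( D_H(t) < inf { A_1(s) + S_H(x_H; σ_H) + Σ_{h=1}^{H−1} S_h( x_h ; σ_h + γ_h Σ_{k=h+1}^{H} (τ_{k−1} + x_k) ) : s ≥ 0, x_1, …, x_H ≥ 0, s + Σ_{h=1}^H x_h + Σ_{h=1}^{H−1}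 τ_h ≤ t } ) ≤ ε_H(σ_H) + Σ_{h=1}^{H−1} (1/(γ_h τ_h)) ∫_{σ_h}^∞ ε_h(y) dy. -/
open MeasureTheory Set

namespace NetworkServiceCurve

/-- `c` is a lower bound for the values of the concatenated service curve of the first `h` nodes,
where `b` is the time left to be distributed and `r` is the time already spent downstream. -/
def IsPathLowerBound (A : ℝ → ℝ) (S : ℕ → ℝ → ℝ → ℝ) (τ γ σ : ℕ → ℝ) (h : ℕ) (b r c : ℝ) :
    Prop :=
  ∀ (s : ℝ) (x : ℕ → ℝ), 0 ≤ s → (∀ k ∈ Finset.Icc 1 h, 0 ≤ x k) →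
    s + ∑ k ∈ Finset.Icc 1 h, x k ≤ b →
    c ≤ A s + ∑ k ∈ Finset.Icc 1 h,
      S k (x k) (σ k + γ k * (r + ∑ l ∈ Finset.Icc (k + 1) h, (τ (l - 1) + x l)))

variable {A : ℝ → ℝ} {S : ℕ → ℝ → ℝ → ℝ} {τ γ σ : ℕ → ℝ} {h : ℕ} {b r c t : ℝ}

/-- Peeling off the last node, at which the time `y` is spent. -/
theorem IsPathLowerBound.peel (hc : IsPathLowerBound A S τ γ σ (h + 1) b r c) {y : ℝ}
    (hy : 0 ≤ y) :
    IsPathLowerBound A S τ γ σ h (b - y) (r + y + τ h)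
      (c - S (h + 1) y (σ (h + 1) + γ (h + 1) * r)) := by
  intro s x hs hx hb
  have hne : ∀ k ∈ Finset.Icc 1 h, Function.update x (h + 1) y k = x k := by
    intro k hk
    rw [Finset.mem_Icc] at hk
    exact Function.update_of_ne (by lia) _ _
  have key := hc s (Function.update x (h + 1) y) hs ?_ ?_
  · rw [Finset.sum_Icc_succ_top (by lia)] at key
    have hsum : ∑ k ∈ Finset.Icc 1 h, S k (Function.update x (h + 1) y k)
          (σ k + γ k * (r + ∑ l ∈ Finset.Icc (k + 1) (h + 1),
            (τ (l - 1) + Function.update x (h + 1) y l))) =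
        ∑ k ∈ Finset.Icc 1 h, S k (x k)
          (σ k + γ k * (r + y + τ h + ∑ l ∈ Finset.Icc (k + 1) h, (τ (l - 1) + x l))) := by
      refine Finset.sum_congr rfl fun k hk => ?_
      have hkh := Finset.mem_Icc.1 hk
      have hinner : ∑ l ∈ Finset.Icc (k + 1) h, (τ (l - 1) + Function.update x (h + 1) y l) =
          ∑ l ∈ Finset.Icc (k + 1) h, (τ (l - 1) + x l) := by
        refine Finset.sum_congr rfl fun l hl => ?_
        rw [hne l (by rw [Finset.mem_Icc] at hl ⊢; lia)]
      rw [hne k hk, Finset.sum_Icc_succ_top (by lia), hinner, Function.update_self,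
        Nat.add_sub_cancel]
      congr 3
      ring
    rw [hsum] at key
    simp only [Function.update_self, Finset.Icc_eq_empty_of_lt (Nat.lt_succ_self (h + 1)),
      Finset.sum_empty, add_zero] at key
    linarith
  · intro k hk
    rw [Finset.mem_Icc] at hk
    rcases eq_or_ne k (h + 1) with rfl | hk'
    · simpa using hy
    · rw [Function.update_of_ne hk']
      exact hx k (Finset.mem_Icc.2 (by lia))
  · rw [Finset.sum_Icc_succ_top (by lia), Finset.sum_congr rfl hne, Function.update_self]
    linarith

theorem IsPathLowerBound.nonpos (hA : A 0 = 0) (hτ : ∀ k ∈ Finset.Icc 1 h, 0 ≤ τ k)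
    (hS : ∀ k ∈ Finset.Icc 1 h, ∀ r, τ k ≤ r → S k 0 (σ k + γ k * r) ≤ 0)
    (hb : 0 ≤ b) (hr : 1 ≤ h → τ h ≤ r) (hc : IsPathLowerBound A S τ γ σ h b r c) : c ≤ 0 := by
  induction h generalizing b r c with
  | zero => simpa [hA] using hc 0 0 le_rfl (by simp) (by simpa using hb)
  | succ h ih =>
    have hr' := hr (by lia)
    have hτ' := hτ (h + 1) (by simp)
    have hsub : ∀ k ∈ Finset.Icc 1 h, k ∈ Finset.Icc 1 (h + 1) := by
      intro k hk
      rw [Finset.mem_Icc] at hk ⊢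
      lia
    have := ih (fun k hk => hτ k (hsub k hk)) (fun k hk => hS k (hsub k hk)) (by linarith)
      (fun _ => by linarith) (hc.peel le_rfl)
    linarith [hS (h + 1) (by simp) r hr']

variable {D : ℕ → ℝ → ℝ}

/-- One node of the induction: a bound on the departures of node `h` turns a path lower bound for
`h + 1` nodes into a lower bound for the service received at node `h + 1` alone. -/
theorem IsPathLowerBound.le_add_service {z : ℝ} (hD0 : D 0 0 = 0)
    (hDnn : ∀ s, 0 ≤ s → 0 ≤ D h s) (hτ : ∀ k ∈ Finset.Icc 1 h, 0 ≤ τ k)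
    (hS : ∀ k ∈ Finset.Icc 1 h, ∀ r, τ k ≤ r → S k 0 (σ k + γ k * r) ≤ 0)
    (hSmono : ∀ σ s t, 0 ≤ s → s ≤ t → S (h + 1) s σ ≤ S (h + 1) t σ)
    (hDh : ∀ u c, ∑ k ∈ Finset.Icc 1 h, τ k ≤ u → u ≤ t →
      IsPathLowerBound (D 0) S τ γ σ h (u - ∑ k ∈ Finset.Icc 1 h, τ k) (t - u + τ h) c → c ≤ D h u)
    (hz : ∑ k ∈ Finset.Icc 1 h, τ k ≤ z) (hzt : z ≤ t)
    (hc : IsPathLowerBound (D 0) S τ γ σ (h + 1) (z - ∑ k ∈ Finset.Icc 1 h, τ k) (t - z) c)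
    {v : ℝ} (hv : 0 ≤ v) (hvz : v ≤ z) :
    c ≤ D h v + S (h + 1) (z - v) (σ (h + 1) + γ (h + 1) * (t - z)) := by
  rcases le_or_gt (∑ k ∈ Finset.Icc 1 h, τ k) v with hTv | hTv
  · have := hc.peel (y := z - v) (by linarith)
    rw [show z - ∑ k ∈ Finset.Icc 1 h, τ k - (z - v) = v - ∑ k ∈ Finset.Icc 1 h, τ k by ring,
      show t - z + (z - v) + τ h = t - v + τ h by ring] at this
    linarith [hDh v _ hTv (hvz.trans hzt) this]
  · have := (hc.peel (y := z - ∑ k ∈ Finset.Icc 1 h, τ k) (by linarith)).nonpos hD0 hτ hS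
      (by linarith) (fun _ => by linarith)
    linarith [hDnn v hv, hSmono (σ (h + 1) + γ (h + 1) * (t - z))
      (z - ∑ k ∈ Finset.Icc 1 h, τ k) (z - v) (by linarith) (by linarith)]

theorem IsPathLowerBound.le_departure {n : ℕ} (hD0 : D 0 0 = 0)
    (hDnn : ∀ h s, 0 ≤ s → 0 ≤ D h s) (hτ : ∀ k ∈ Finset.Icc 1 n, 0 ≤ τ k)
    (hS : ∀ k ∈ Finset.Icc 1 n, ∀ r, τ k ≤ r → S k 0 (σ k + γ k * r) ≤ 0)
    (hSmono : ∀ k ∈ Finset.Icc 1 n, ∀ σ s t, 0 ≤ s → s ≤ t → S k s σ ≤ S k t σ)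
    (hnode : ∀ h ∈ Finset.Icc 1 n, ∀ z c, 0 ≤ z → z + τ h ≤ t →
      (∀ v, 0 ≤ v → v ≤ z → c ≤ D (h - 1) v + S h (z - v) (σ h + γ h * (t - z))) →
      c ≤ D h (z + τ h))
    (hn : h ≤ n) {u : ℝ} (hu : ∑ k ∈ Finset.Icc 1 h, τ k ≤ u) (hut : u ≤ t)
    (hc : IsPathLowerBound (D 0) S τ γ σ h (u - ∑ k ∈ Finset.Icc 1 h, τ k) (t - u + τ h) c) :
    c ≤ D h u := by
  induction h generalizing u c with
  | zero => simpa using hc u 0 (by simpa using hu) (by simp) (by simp)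
  | succ h ih =>
    have hsub : ∀ k ∈ Finset.Icc 1 h, k ∈ Finset.Icc 1 n := by
      intro k hk
      rw [Finset.mem_Icc] at hk ⊢
      lia
    have hmem : h + 1 ∈ Finset.Icc 1 n := Finset.mem_Icc.2 (by lia)
    have hτh := hτ _ hmem
    rw [Finset.sum_Icc_succ_top (by lia)] at hu hc
    rw [show u - (∑ k ∈ Finset.Icc 1 h, τ k + τ (h + 1)) =
        u - τ (h + 1) - ∑ k ∈ Finset.Icc 1 h, τ k by ring,
      show t - u + τ (h + 1) = t - (u - τ (h + 1)) by ring] at hc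
    have hT : 0 ≤ ∑ k ∈ Finset.Icc 1 h, τ k := Finset.sum_nonneg fun k hk => hτ k (hsub k hk)
    have := hnode (h + 1) hmem (u - τ (h + 1)) c (by linarith) (by linarith) fun v hv hvz =>
      hc.le_add_service hD0 (hDnn h) (fun k hk => hτ k (hsub k hk)) (fun k hk => hS k (hsub k hk))
        (hSmono _ hmem) (fun u c hu hut hc => ih (by lia) hu hut hc) (by linarith) (by linarith)
        hv hvz
    simpa using this

/-- A service guarantee on the grid `t - (j + 1) * τ` extends to all times, at the expense of
a delay `τ`. -/
theorem le_departure_of_grid {A D : ℝ → ℝ} {S : ℝ → ℝ → ℝ} {τ γ σ : ℝ}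
    (hA : ∀ s t, 0 ≤ s → s ≤ t → A s ≤ A t) (hD : ∀ s t, 0 ≤ s → s ≤ t → D s ≤ D t)
    (hS : ∀ σ s t, 0 ≤ s → s ≤ t → S s σ ≤ S t σ)
    (hS' : ∀ t σ σ', 0 ≤ σ → σ ≤ σ' → S t σ' ≤ S t σ)
    (hτ : 0 < τ) (hγ : 0 < γ) (hσ : 0 ≤ σ)
    (hgrid : ∀ j : ℕ, 0 ≤ t - (j + 1) * τ →
      ⨅ s : Icc (0 : ℝ) (t - (j + 1) * τ),
        (A ↑s + S (t - (j + 1) * τ - ↑s) (σ + (j + 1) * (γ * τ))) ≤ D (t - (j + 1) * τ))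
    {z c : ℝ} (hz : 0 ≤ z) (hzt : z + τ ≤ t)
    (hc : ∀ v, 0 ≤ v → v ≤ z → c ≤ A v + S (z - v) (σ + γ * (t - z))) :
    c ≤ D (z + τ) := by
  obtain ⟨j, hj⟩ : ∃ j : ℕ, ⌊(t - z) / τ⌋₊ = j + 1 := by
    refine Nat.exists_eq_succ_of_ne_zero (Nat.pos_iff_ne_zero.1 (Nat.floor_pos.2 ?_))
    rw [le_div_iff₀ hτ]
    linarith
  have hlo : ((j : ℝ) + 1) * τ ≤ t - z := by
    have := Nat.floor_le (show 0 ≤ (t - z) / τ from div_nonneg (by linarith) hτ.le)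
    rw [hj, le_div_iff₀ hτ] at this
    exact_mod_cast this
  have hhi : t - z < ((j : ℝ) + 1) * τ + τ := by
    have := Nat.lt_floor_add_one ((t - z) / τ)
    rw [hj, div_lt_iff₀ hτ] at this
    push_cast at this
    linarith
  have hg := hgrid j (by linarith)
  set g := t - ((j : ℝ) + 1) * τ with hgdef
  have hlevel : σ + ((j : ℝ) + 1) * (γ * τ) ≤ σ + γ * (t - z) := by
    nlinarith [mul_le_mul_of_nonneg_left hlo hγ.le]
  have hlevel0 : 0 ≤ σ + ((j : ℝ) + 1) * (γ * τ) := by positivity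
  have : Nonempty (Icc (0 : ℝ) g) := ⟨⟨0, le_rfl, by linarith⟩⟩
  refine le_trans (le_ciInf fun s => ?_) (hg.trans (hD _ _ (by linarith) (by linarith)))
  obtain ⟨s, hs0, hsg⟩ := s
  refine le_trans ?_ (add_le_add_right (hS' (g - s) _ _ hlevel0 hlevel) (A s))
  rcases le_total s z with hsz | hsz
  · linarith [hc s hs0 hsz, hS (σ + γ * (t - z)) (z - s) (g - s) (by linarith) (by linarith)]
  · linarith [hc z hz le_rfl, hA z s hz hsz,
      hS (σ + γ * (t - z)) (z - z) (g - s) (by linarith) (by linarith)]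

theorem tsum_ofReal_le_lintegral {f : ℝ → ℝ} {a σ : ℝ} (ha : 0 < a)
    (hf : ∀ x y, σ ≤ x → x ≤ y → f y ≤ f x) :
    ∑' j : ℕ, ENNReal.ofReal (f (σ + (j + 1) * a)) ≤
      ENNReal.ofReal (1 / a) * ∫⁻ y in Ici σ, ENNReal.ofReal (f y) := by
  let p : ℕ → ℝ := fun j => σ + j * a
  have hp : Monotone p := fun i j hij => by
    have : (i : ℝ) ≤ j := by exact_mod_cast hij
    simp only [p]
    gcongr
  have hsub : ⋃ j, Ioc (p j) (p (j + 1)) ⊆ Ici σ := by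
    refine iUnion_subset fun j y hy => ?_
    have : (0 : ℝ) ≤ j * a := by positivity
    simp only [p, mem_Ioc] at hy
    exact mem_Ici.2 (by linarith)
  have hcell : ∀ j : ℕ, ENNReal.ofReal (f (σ + (j + 1) * a)) ≤
      ENNReal.ofReal (1 / a) * ∫⁻ y in Ioc (p j) (p (j + 1)), ENNReal.ofReal (f y) := by
    intro j
    have hconst : ∫⁻ _ in Ioc (p j) (p (j + 1)), ENNReal.ofReal (f (σ + (j + 1) * a)) ≤
        ∫⁻ y in Ioc (p j) (p (j + 1)), ENNReal.ofReal (f y) := by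
      refine setLIntegral_mono' measurableSet_Ioc fun y hy => ENNReal.ofReal_le_ofReal ?_
      have hy' := hsub (mem_iUnion_of_mem j hy)
      refine hf y _ hy' ?_
      simpa [p] using hy.2
    rw [setLIntegral_const, Real.volume_Ioc] at hconst
    refine le_trans (le_of_eq ?_) (mul_le_mul_right hconst _)
    rw [show p (j + 1) - p j = a by simp only [p]; push_cast; ring, mul_left_comm,
      ← ENNReal.ofReal_mul (by positivity), one_div, inv_mul_cancel₀ ha.ne', ENNReal.ofReal_one,
      mul_one]
  calc ∑' j : ℕ, ENNReal.ofReal (f (σ + (j + 1) * a))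
      ≤ ∑' j : ℕ, ENNReal.ofReal (1 / a) *
          ∫⁻ y in Ioc (p j) (p (j + 1)), ENNReal.ofReal (f y) := ENNReal.tsum_le_tsum hcell
    _ = ENNReal.ofReal (1 / a) *
          ∫⁻ y in ⋃ j, Ioc (p j) (p (j + 1)), ENNReal.ofReal (f y) := by
        rw [ENNReal.tsum_mul_left, lintegral_iUnion (s := fun j => Ioc (p j) (p (j + 1)))
          (fun _ => measurableSet_Ioc) hp.pairwise_disjoint_on_Ioc_succ]
    _ ≤ _ := by
        gcongr

end NetworkServiceCurve

open NetworkServiceCurve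

/-- Intermediate form of the network service curve (Eq. (10)). Nodes are indexed
`1, …, H`; `D 0` is the arrival process `A_1` of the flow to the first node, and
`D h` is the departure process of node `h`, which is the arrival to node `h+1`. -/
theorem network_service_curve_intermediate
    {Ω : Type*} [MeasurableSpace Ω] (P : Measure Ω) [IsProbabilityMeasure P]
    (H : ℕ) (hH : 1 ≤ H)
    (D : ℕ → Ω → ℝ → ℝ)
    (hD_zero : ∀ h ω, D h ω 0 = 0)
    (hD_mono : ∀ h ω s t, 0 ≤ s → s ≤ t → D h ω s ≤ D h ω t)
    (hD_nonneg : ∀ h ω t, 0 ≤ t → 0 ≤ D h ω t)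
    (hD_le : ∀ h ∈ Finset.Icc 1 H, ∀ ω, ∀ t : ℝ, 0 ≤ t → D h ω t ≤ D (h - 1) ω t)
    (S : ℕ → ℝ → ℝ → ℝ) (ε : ℕ → ℝ → ℝ)
    (hS_mono_t : ∀ h ∈ Finset.Icc 1 H, ∀ σ s t : ℝ, 0 ≤ s → s ≤ t → S h s σ ≤ S h t σ)
    (hS_anti : ∀ h ∈ Finset.Icc 1 H, ∀ t σ σ' : ℝ, 0 ≤ σ → σ ≤ σ' → S h t σ' ≤ S h t σ)
    (hε_anti : ∀ h ∈ Finset.Icc 1 H, ∀ σ σ' : ℝ, 0 ≤ σ → σ ≤ σ' → ε h σ' ≤ ε h σ)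
    (hε_int : ∀ h ∈ Finset.Ico 1 H, (∫⁻ y in Ici (0:ℝ), ENNReal.ofReal (ε h y)) < ⊤)
    (hS : ∀ h ∈ Finset.Icc 1 H, ∀ t σ : ℝ, 0 ≤ t → 0 ≤ σ →
      P {ω | D h ω t < ⨅ s : Icc (0:ℝ) t, (D (h - 1) ω ↑s + S h (t - ↑s) σ)}
        ≤ ENNReal.ofReal (ε h σ))
    (τ γ σ : ℕ → ℝ)
    (hτ : ∀ h ∈ Finset.Ico 1 H, 0 < τ h) (hγ : ∀ h ∈ Finset.Ico 1 H, 0 < γ h)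
    (hσ : ∀ h ∈ Finset.Icc 1 H, 0 ≤ σ h)
    (t : ℝ) (ht : 0 ≤ t) :
    P {ω | D H ω t < sInf {v : ℝ | ∃ (s : ℝ) (x : ℕ → ℝ), 0 ≤ s ∧
        (∀ h ∈ Finset.Icc 1 H, 0 ≤ x h) ∧
        s + (∑ h ∈ Finset.Icc 1 H, x h) + (∑ h ∈ Finset.Ico 1 H, τ h) ≤ t ∧
        v = D 0 ω s + S H (x H) (σ H) +
          ∑ h ∈ Finset.Ico 1 H,
            S h (x h) (σ h + γ h * ∑ k ∈ Finset.Icc (h + 1) H, (τ (k - 1) + x k))}}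
      ≤ ENNReal.ofReal (ε H (σ H)) +
        ∑ h ∈ Finset.Ico 1 H,
          ENNReal.ofReal (1 / (γ h * τ h)) * ∫⁻ y in Ici (σ h), ENNReal.ofReal (ε h y) := by
  obtain ⟨n, rfl⟩ : ∃ n, H = n + 1 := ⟨H - 1, by lia⟩
  have hIco : Finset.Ico 1 (n + 1) = Finset.Icc 1 n := by
    ext k
    simp only [Finset.mem_Ico, Finset.mem_Icc]
    lia
  rw [hIco] at hτ hγ hε_int ⊢
  have hsub : ∀ k ∈ Finset.Icc 1 n, k ∈ Finset.Icc 1 (n + 1) := by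
    intro k hk
    rw [Finset.mem_Icc] at hk ⊢
    lia
  have hlast : n + 1 ∈ Finset.Icc 1 (n + 1) := by simp
  have hgridsum : ∀ h ∈ Finset.Icc 1 n,
      ∑' j : ℕ, ENNReal.ofReal (ε h (σ h + (j + 1) * (γ h * τ h))) ≤
        ENNReal.ofReal (1 / (γ h * τ h)) * ∫⁻ y in Ici (σ h), ENNReal.ofReal (ε h y) :=
    fun h hh => tsum_ofReal_le_lintegral (mul_pos (hγ h hh) (hτ h hh)) fun x y hx hxy =>
      hε_anti h (hsub h hh) x y ((hσ h (hsub h hh)).trans hx) hxy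
  by_cases hS0 : ∀ k ∈ Finset.Icc 1 n, S k 0 (σ k + γ k * τ k) ≤ 0
  swap
  · push Not at hS0
    obtain ⟨k, hk, hpos⟩ := hS0
    have hlevel : 0 ≤ σ k + γ k * τ k :=
      add_nonneg (hσ k (hsub k hk)) (mul_pos (hγ k hk) (hτ k hk)).le
    have hone : 1 ≤ ENNReal.ofReal (ε k (σ k + γ k * τ k)) := by
      refine le_trans (le_of_eq ?_) (hS k (hsub k hk) 0 _ le_rfl hlevel)
      rw [← measure_univ (μ := P)]
      congr 1
      refine (eq_univ_of_forall fun ω => ?_).symm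
      have : Nonempty (Icc (0 : ℝ) 0) := ⟨⟨0, le_rfl, le_rfl⟩⟩
      rw [mem_ofPred_eq, hD_zero]
      refine lt_of_lt_of_le hpos (le_ciInf fun s => ?_)
      obtain ⟨s, hs⟩ := s
      obtain rfl : s = 0 := le_antisymm hs.2 hs.1
      simp [hD_zero]
    calc _ ≤ (1 : ENNReal) := prob_le_one
      _ ≤ ENNReal.ofReal (ε k (σ k + ((0 : ℕ) + 1) * (γ k * τ k))) := by simpa using hone
      _ ≤ ∑' j : ℕ, ENNReal.ofReal (ε k (σ k + (j + 1) * (γ k * τ k))) :=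
        ENNReal.le_tsum (f := fun j : ℕ => ENNReal.ofReal (ε k (σ k + (j + 1) * (γ k * τ k)))) 0
      _ ≤ _ := hgridsum k hk
      _ ≤ _ := Finset.single_le_sum (f := fun h => ENNReal.ofReal (1 / (γ h * τ h)) *
          ∫⁻ y in Ici (σ h), ENNReal.ofReal (ε h y)) (fun _ _ => zero_le) hk
      _ ≤ _ := le_add_self
  let B : ℕ → ℝ → ℝ → Set Ω := fun h u θ =>
    {ω | D h ω u < ⨅ s : Icc (0:ℝ) u, (D (h - 1) ω ↑s + S h (u - ↑s) θ)}
  let G : ℕ → ℕ → Set Ω := fun h j =>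
    {ω | 0 ≤ t - (j + 1) * τ h ∧ ω ∈ B h (t - (j + 1) * τ h) (σ h + (j + 1) * (γ h * τ h))}
  have hG : ∀ h ∈ Finset.Icc 1 n, ∀ j : ℕ,
      P (G h j) ≤ ENNReal.ofReal (ε h (σ h + (j + 1) * (γ h * τ h))) := by
    intro h hh j
    by_cases hj : 0 ≤ t - (j + 1) * τ h
    · have hlevel : 0 ≤ σ h + (j + 1) * (γ h * τ h) := by
        have := hσ h (hsub h hh)
        have := hγ h hh
        have := hτ h hh
        positivity
      exact (measure_mono fun ω hω => hω.2).trans (hS h (hsub h hh) _ _ hj hlevel)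
    · have : G h j = ∅ := eq_empty_of_forall_notMem fun ω hω => hj hω.1
      simp [this]
  calc _ ≤ P (B (n + 1) t (σ (n + 1)) ∪ ⋃ h ∈ Finset.Icc 1 n, ⋃ j, G h j) := ?_
    _ ≤ P (B (n + 1) t (σ (n + 1))) + P (⋃ h ∈ Finset.Icc 1 n, ⋃ j, G h j) := measure_union_le _ _
    _ ≤ _ := by
      refine add_le_add (hS _ hlast t _ ht (hσ _ hlast))
        ((measure_biUnion_finset_le _ _).trans (Finset.sum_le_sum fun h hh => ?_))
      exact (measure_iUnion_le _).trans
        ((ENNReal.tsum_le_tsum (hG h hh)).trans (hgridsum h hh))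
  refine measure_mono fun ω hω => ?_
  by_contra hgood
  simp only [mem_union, mem_iUnion, not_or, not_exists] at hgood
  obtain ⟨hgoodH, hgoodG⟩ := hgood
  rw [mem_ofPred_eq] at hω
  revert hω
  rw [imp_false, not_lt]
  set V : Set ℝ := {v : ℝ | ∃ (s : ℝ) (x : ℕ → ℝ), 0 ≤ s ∧ _} with hV
  by_cases hbdd : BddBelow V
  swap
  · rw [Real.sInf_of_not_bddBelow hbdd]
    exact hD_nonneg _ _ _ ht
  rcases V.eq_empty_or_nonempty with hempty | ⟨_, s₀, x₀, hs₀, hx₀, hle₀, -⟩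
  · rw [hempty, Real.sInf_empty]
    exact hD_nonneg _ _ _ ht
  have hT : ∑ k ∈ Finset.Icc 1 n, τ k ≤ t := by
    linarith [Finset.sum_nonneg hx₀]
  have hpath : IsPathLowerBound (D 0 ω) S τ γ σ (n + 1)
      (t - ∑ k ∈ Finset.Icc 1 n, τ k) (t - t) (sInf V) := by
    intro s x hs hx hle
    refine csInf_le hbdd ⟨s, x, hs, hx, by linarith, ?_⟩
    rw [Finset.sum_Icc_succ_top (by lia)]
    simp only [sub_self, zero_add, Finset.Icc_eq_empty_of_lt (Nat.lt_succ_self (n + 1)),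
      Finset.sum_empty, mul_zero, add_zero]
    ring
  have hτ0 : ∀ k ∈ Finset.Icc 1 n, 0 ≤ τ k := fun k hk => (hτ k hk).le
  have hSle : ∀ k ∈ Finset.Icc 1 n, ∀ r, τ k ≤ r → S k 0 (σ k + γ k * r) ≤ 0 := by
    intro k hk r hr
    have h1 := mul_le_mul_of_nonneg_left hr (hγ k hk).le
    exact (hS_anti k (hsub k hk) 0 _ _ (add_nonneg (hσ k (hsub k hk))
      (mul_pos (hγ k hk) (hτ k hk)).le) (by linarith)).trans (hS0 k hk)
  have hnode : ∀ h ∈ Finset.Icc 1 n, ∀ z c, 0 ≤ z → z + τ h ≤ t →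
      (∀ v, 0 ≤ v → v ≤ z → c ≤ D (h - 1) ω v + S h (z - v) (σ h + γ h * (t - z))) →
      c ≤ D h ω (z + τ h) := by
    intro h hh z c hz hzt hc
    refine le_departure_of_grid (hD_mono (h - 1) ω) (hD_mono h ω) (hS_mono_t h (hsub h hh))
      (hS_anti h (hsub h hh)) (hτ h hh) (hγ h hh) (hσ h (hsub h hh)) (fun j hj => ?_) hz hzt hc
    exact not_lt.1 fun hlt => hgoodG h hh j ⟨hj, hlt⟩
  have : Nonempty (Icc (0 : ℝ) t) := ⟨⟨0, le_rfl, ht⟩⟩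
  refine le_trans (le_ciInf fun v => ?_) (not_lt.1 hgoodH)
  have := hpath.le_add_service (D := fun h => D h ω) (hD_zero 0 ω) (hD_nonneg n ω) hτ0 hSle
    (hS_mono_t _ hlast)
    (fun u c hu hut hc => hc.le_departure (D := fun h => D h ω) (hD_zero 0 ω)
      (fun h => hD_nonneg h ω) hτ0 hSle (fun k hk => hS_mono_t k (hsub k hk)) hnode le_rfl hu hut)
    hT le_rfl v.2.1 v.2.2
  simpa using this
end

section
/- (Network service curve for a path of Δ-schedulers with EBB cross traffic, Eq. (21).) Consider H ≥ 2 nodes in tandem with arrival process A_1 to node 1, departure processes D_h, and A_{h+1} := D_h. Let C_h > 0, ρ_h ≥ 0, α_h > 0, M_h ≥ 0, Δ^h ∈ ℝ with Δ^h(θ) := min{θ, Δ^h}, and let γ satisfy 0 < Hγ < min_h (C_h − ρ_h). Assume that for every h, every θ ≥ 0, every x ≥ 0 and t ≥ 0: ℙ( D_h(t) < inf_{0 ≤ s ≤ t} { A_h(s) + S_h^θ(t−s; x) } ) ≤ M_h e (1 + ρ_h/γ) e^{−α_h x}, where S_h^θ(u; x) := [ C_h u − [ (ρ_h + γ)(u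 − θ + Δ^h(θ)) + x ]_+ ]_+ for u > θ and := 0 for u ≤ θ. Fix σ_1, …, σ_H ≥ 0, a constant τ_net > 0, and θ_1, …, θ_H ≥ 0 large enough that U_h := (C_h − (H−1)γ) θ_h − [ (ρ_h + γ) Δ^h(θ_h) + σ_h ]_+ ≥ 0 for each h. Define S̃_h(u) := min{ (C_h − (H−1)γ)(u + θ_h), (C_h − ρ_h − Hγ) u + U_h } for u > 0 and S̃_h(u) := 0 for u ≤ 0; S̃_net(u) := min_{1 ≤ h ≤ H} S̃_h(u); and a := τ_net + Σ_{h=1}^H θ_h. Then for every t ≥ 0: ℙ( D_H(t) < inf_{0 ≤ s ≤ t} { A_1(s) + max{ S̃_net(t − s − a) − (H−1) γ τ_net , 0 }·1_{t−s > a} } ) ≤ M_H e (1 + ρ_H/γ) e^{−α_H σ_H} + ((Σ_{h=1}^{H−1} α_h^{−1}) / (γ τ_net)) Σ_{h=1}^{H−1} M_h e (1 + ρ_h/γ) e^{−α_h σ_h}. -/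
open MeasureTheory Set

/-- The statistical service curve offered by a Δ-scheduler with parameter `Δ`
at a link of capacity `C` with EBB cross traffic of rate `ρ` (relaxed concave
form, Eq. (17)): `S^θ(u;x) = [C u − [(ρ+γ)(u − θ + Δ(θ)) + x]_+]_+` for `u > θ`
and `0` for `u ≤ θ`, where `Δ(θ) = min{θ, Δ}`. -/
noncomputable def Sdelta (C ρ γ Δ θ u x : ℝ) : ℝ :=
  if u ≤ θ then 0 else max (C * u - max ((ρ + γ) * (u - θ + min θ Δ) + x) 0) 0

/-- `U_h = (C_h − (H−1)γ)θ_h − [(ρ_h+γ)Δ^h(θ_h) + σ_h]_+` (Eq. (18)). -/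
noncomputable def Uconst (Hr C ρ γ Δ θ σ : ℝ) : ℝ :=
  (C - (Hr - 1) * γ) * θ - max ((ρ + γ) * min θ Δ + σ) 0

/-- `S̃_h(u) = min{(C_h − (H−1)γ)(u + θ_h), (C_h − ρ_h − Hγ)u + U_h}` for `u > 0`
and `0` for `u ≤ 0` (Eq. (19)). -/
noncomputable def Stilde (Hr C ρ γ θ U u : ℝ) : ℝ :=
  if u ≤ 0 then 0 else min ((C - (Hr - 1) * γ) * (u + θ)) ((C - ρ - Hr * γ) * u + U)

/-- The service of a Δ-scheduler beyond its latency `θ`, with burst allowance enlarged by `γ X`,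
dominates `S̃` up to the rate reserve `(Hr - 1) γ` and the loss `γ X`. -/
theorem Stilde_add_le_Sdelta {Hr C ρ γ Δ θ σ X w : ℝ} (hHr : 1 ≤ Hr) (hγ : 0 ≤ γ) (hθ : 0 ≤ θ)
    (hX : 0 ≤ X) (hw : 0 < w) :
    Stilde Hr C ρ γ θ (Uconst Hr C ρ γ Δ θ σ) w + (Hr - 1) * γ * w - γ * X ≤
      Sdelta C ρ γ Δ θ (w + θ) (σ + γ * X) := by
  have h1 : 0 ≤ (Hr - 1) * γ * θ := mul_nonneg (mul_nonneg (by linarith) hγ) hθ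
  have h2 : 0 ≤ γ * X := mul_nonneg hγ hX
  rw [Stilde, Sdelta, if_neg (not_le.mpr hw), if_neg (by linarith)]
  refine le_trans ?_ (le_max_left _ _)
  have ha := min_le_left ((C - (Hr - 1) * γ) * (w + θ))
    ((C - ρ - Hr * γ) * w + Uconst Hr C ρ γ Δ θ σ)
  have hb := min_le_right ((C - (Hr - 1) * γ) * (w + θ))
    ((C - ρ - Hr * γ) * w + Uconst Hr C ρ γ Δ θ σ)
  generalize min ((C - (Hr - 1) * γ) * (w + θ))
    ((C - ρ - Hr * γ) * w + Uconst Hr C ρ γ Δ θ σ) = m at ha hb ⊢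
  have hc : (ρ + γ) * min θ Δ + σ ≤ max ((ρ + γ) * min θ Δ + σ) 0 := le_max_left _ _
  rw [Uconst] at hb
  rcases max_cases ((ρ + γ) * (w + θ - θ + min θ Δ) + (σ + γ * X)) 0 with h | h <;>
    rw [h.1] <;> nlinarith

theorem Sdelta_nonneg (C ρ γ Δ θ u x : ℝ) : 0 ≤ Sdelta C ρ γ Δ θ u x := by
  rw [Sdelta]
  split_ifs
  · exact le_rfl
  · exact le_max_right _ _

theorem Stilde_of_nonpos {Hr C ρ γ θ U u : ℝ} (hu : u ≤ 0) : Stilde Hr C ρ γ θ U u = 0 :=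
  if_pos hu

theorem Stilde_mono {Hr C ρ γ θ U u v : ℝ} (h1 : 0 ≤ C - (Hr - 1) * γ) (h2 : 0 ≤ C - ρ - Hr * γ)
    (hu : 0 < u) (huv : u ≤ v) : Stilde Hr C ρ γ θ U u ≤ Stilde Hr C ρ γ θ U v := by
  rw [Stilde, Stilde, if_neg (not_le.mpr hu), if_neg (by linarith)]
  gcongr

/-- `S̃` is star-shaped, by concavity and nonnegativity at `0+`. -/
theorem div_mul_Stilde_le {Hr C ρ γ θ U w W : ℝ} (h1 : 0 ≤ C - (Hr - 1) * γ) (hθ : 0 ≤ θ)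
    (hU : 0 ≤ U) (hw : 0 ≤ w) (hwW : w ≤ W) (hW : 0 < W) :
    w / W * Stilde Hr C ρ γ θ U W ≤ Stilde Hr C ρ γ θ U w := by
  rcases hw.eq_or_lt with rfl | hw
  · simp [Stilde]
  have hr : w / W ≤ 1 := (div_le_one hW).mpr hwW
  have hr0 : 0 ≤ w / W := by positivity
  have hrW : w / W * W = w := div_mul_cancel₀ _ hW.ne'
  rw [Stilde, Stilde, if_neg (not_le.mpr hw), if_neg (not_le.mpr hW)]
  refine le_min ?_ ?_
  · refine (mul_le_mul_of_nonneg_left (min_le_left _ _) hr0).trans ?_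
    have := mul_nonneg (mul_nonneg h1 hθ) (sub_nonneg.mpr hr)
    calc w / W * ((C - (Hr - 1) * γ) * (W + θ))
        = (C - (Hr - 1) * γ) * (w / W * W + w / W * θ) := by ring
      _ ≤ _ := by rw [hrW]; nlinarith
  · refine (mul_le_mul_of_nonneg_left (min_le_right _ _) hr0).trans ?_
    have := mul_nonneg hU (sub_nonneg.mpr hr)
    calc w / W * ((C - ρ - Hr * γ) * W + U)
        = (C - ρ - Hr * γ) * (w / W * W) + w / W * U := by ring
      _ ≤ _ := by rw [hrW]; nlinarith

/-- Splitting an interval of length at least `v` among star-shaped monotone curves yields at least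
their pointwise minimum at `v`. -/
theorem inf'_Stilde_le_sum {ι : Type*} {I : Finset ι} (hI : I.Nonempty) {Hr γ v : ℝ}
    {C ρ θ U w : ι → ℝ} (h1 : ∀ h ∈ I, 0 ≤ C h - (Hr - 1) * γ)
    (h2 : ∀ h ∈ I, 0 ≤ C h - ρ h - Hr * γ) (hθ : ∀ h ∈ I, 0 ≤ θ h) (hU : ∀ h ∈ I, 0 ≤ U h)
    (hw : ∀ h ∈ I, 0 ≤ w h) (hv : 0 < v) (hvw : v ≤ ∑ h ∈ I, w h) :
    I.inf' hI (fun h => Stilde Hr (C h) (ρ h) γ (θ h) (U h) v) ≤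
      ∑ h ∈ I, Stilde Hr (C h) (ρ h) γ (θ h) (U h) (w h) := by
  set W := ∑ h ∈ I, w h with hWdef
  have hW : 0 < W := hv.trans_le hvw
  set m := I.inf' hI (fun h => Stilde Hr (C h) (ρ h) γ (θ h) (U h) v) with hm
  calc m = ∑ h ∈ I, w h / W * m := by
        rw [← Finset.sum_mul, ← Finset.sum_div, ← hWdef, div_self hW.ne', one_mul]
    _ ≤ _ := by
        refine Finset.sum_le_sum fun h hh => ?_
        refine le_trans ?_ (div_mul_Stilde_le (h1 h hh) (hθ h hh) (hU h hh) (hw h hh)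
          (Finset.single_le_sum (f := w) hw hh) hW)
        refine mul_le_mul_of_nonneg_left ?_ (div_nonneg (hw h hh) hW.le)
        exact (Finset.inf'_le (fun h => Stilde Hr (C h) (ρ h) γ (θ h) (U h) v) hh).trans
          (Stilde_mono (h1 h hh) (h2 h hh) hv hvw)

/-- One node: an arrival epoch at least `θ` in the past witnesses the service guarantee, up to an
arbitrarily small error. -/
theorem exists_arrival_epoch {A B : ℝ → ℝ} {Hr C ρ γ Δ θ σ X r δ : ℝ}
    (hA : ∀ s t, 0 ≤ s → s ≤ t → A s ≤ A t) (hHr : 1 ≤ Hr) (hγ : 0 ≤ γ) (hθ : 0 ≤ θ)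
    (hX : 0 ≤ X) (hr : θ ≤ r) (hδ : 0 < δ)
    (hB : (⨅ s : Icc (0 : ℝ) r, (A ↑s + Sdelta C ρ γ Δ θ (r - ↑s) (σ + γ * X))) ≤ B r) :
    ∃ s, 0 ≤ s ∧ s ≤ r - θ ∧ A s ≤ B r + δ ∧
      A s + (Stilde Hr C ρ γ θ (Uconst Hr C ρ γ Δ θ σ) (r - θ - s) + (Hr - 1) * γ * (r - θ - s)
        - γ * X) ≤ B r + δ := by
  have : Nonempty (Icc (0 : ℝ) r) := ⟨⟨0, le_rfl, hθ.trans hr⟩⟩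
  obtain ⟨⟨s, hs0, hsr⟩, hs⟩ := exists_lt_of_ciInf_lt (hB.trans_lt (lt_add_of_pos_right _ hδ))
  simp only at hs
  have hS := Sdelta_nonneg C ρ γ Δ θ (r - s) (σ + γ * X)
  rcases lt_or_ge s (r - θ) with h | h
  · refine ⟨s, hs0, h.le, by linarith, ?_⟩
    have := Stilde_add_le_Sdelta (C := C) (ρ := ρ) (Δ := Δ) (σ := σ) hHr hγ hθ hX (sub_pos.mpr h)
    rw [show r - θ - s + θ = r - s by ring] at this
    linarith
  · have hAs := hA (r - θ) s (by linarith) h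
    refine ⟨r - θ, by linarith, le_rfl, by linarith, ?_⟩
    rw [sub_self, Stilde_of_nonpos le_rfl]
    have := mul_nonneg hγ hX
    linarith

/-- Chaining the nodes `1, …, n` along a sample path on which node `h` meets its service guarantee
at grid times of spacing `τ h` anchored at `T₀ + ∑ k ∈ Icc 1 h, θ k`. -/
theorem exists_chained_epoch {F : ℕ → ℝ → ℝ} {Hr γ T₀ δ : ℝ} {C ρ Δ σ θ τ : ℕ → ℝ} {N : ℕ}
    (hF_zero : ∀ h, F h 0 = 0) (hF_mono : ∀ h s t, 0 ≤ s → s ≤ t → F h s ≤ F h t)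
    (hHr : 1 ≤ Hr) (hγ : 0 ≤ γ) (hδ : 0 < δ) (hθ : ∀ h ∈ Finset.Icc 1 N, 0 ≤ θ h)
    (hτ : ∀ h ∈ Finset.Icc 1 N, 0 < τ h)
    (hgood : ∀ h ∈ Finset.Icc 1 N, ∀ j : ℕ,
      0 ≤ T₀ + ∑ k ∈ Finset.Icc 1 h, θ k - (j + 1) * τ h →
      (⨅ s : Icc (0 : ℝ) (T₀ + ∑ k ∈ Finset.Icc 1 h, θ k - (j + 1) * τ h),
        (F (h - 1) ↑s + Sdelta (C h) (ρ h) γ (Δ h) (θ h)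
          (T₀ + ∑ k ∈ Finset.Icc 1 h, θ k - (j + 1) * τ h - ↑s)
          (σ h + γ * ((j + 1) * τ h)))) ≤
        F h (T₀ + ∑ k ∈ Finset.Icc 1 h, θ k - (j + 1) * τ h))
    (n : ℕ) (hn : n ≤ N) (s : ℝ) (hs : 0 ≤ s) (hsT : s ≤ T₀ + ∑ k ∈ Finset.Icc 1 n, θ k) :
    ∃ s₀ : ℝ, ∃ w : ℕ → ℝ, 0 ≤ s₀ ∧ s₀ ≤ s ∧ (∀ h, 0 ≤ w h) ∧
      s - s₀ ≤ ∑ h ∈ Finset.Icc 1 n, (w h + θ h + τ h) ∧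
      F 0 s₀ ≤ F n s + n * δ ∧
      F 0 s₀ + ∑ h ∈ Finset.Icc 1 n,
          (Stilde Hr (C h) (ρ h) γ (θ h) (Uconst Hr (C h) (ρ h) γ (Δ h) (θ h) (σ h)) (w h)
            + (Hr - 1) * γ * w h)
        - n * γ * (T₀ + ∑ k ∈ Finset.Icc 1 n, θ k - s + ∑ h ∈ Finset.Icc 1 n, (w h + τ h))
        ≤ F n s + n * δ := by
  induction n generalizing s with
  | zero => exact ⟨s, fun _ => 0, hs, le_rfl, fun _ => le_rfl, by simp, by simp, by simp⟩
  | succ n ih =>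
    have hmem : n + 1 ∈ Finset.Icc 1 N := by simp; omega
    have hθ' : ∀ h ∈ Finset.Icc 1 (n + 1), 0 ≤ θ h := fun h hh => hθ h (by simp at hh ⊢; omega)
    have hτ' : ∀ h ∈ Finset.Icc 1 (n + 1), 0 ≤ τ h := fun h hh => (hτ h (by simp at hh ⊢; omega)).le
    have hθn := hθ _ hmem
    have hτn := hτ _ hmem
    set T := T₀ + ∑ k ∈ Finset.Icc 1 (n + 1), θ k with hT
    set j := ⌊(T - s) / τ (n + 1)⌋₊ with hj
    set r := T - (j + 1) * τ (n + 1) with hr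
    have hq : 0 ≤ (T - s) / τ (n + 1) := div_nonneg (sub_nonneg.mpr hsT) hτn.le
    have hj1 : (j : ℝ) * τ (n + 1) ≤ T - s := (le_div_iff₀ hτn).mp (Nat.floor_le hq)
    have hj2 : T - s < (j + 1) * τ (n + 1) := (div_lt_iff₀ hτn).mp (Nat.lt_floor_add_one _)
    have hrs : r ≤ s := by linarith
    have hsr : s - τ (n + 1) ≤ r := by linarith
    have hFs : 0 ≤ F (n + 1) s := by simpa [hF_zero] using hF_mono (n + 1) 0 s le_rfl hs
    rcases lt_or_ge r (θ (n + 1)) with hlt | hge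
    · refine ⟨0, fun _ => 0, le_rfl, hs, fun _ => le_rfl, ?_, ?_, ?_⟩
      · have h1 : θ (n + 1) + τ (n + 1) ≤ ∑ h ∈ Finset.Icc 1 (n + 1), (0 + θ h + τ h) := by
          rw [← zero_add (θ (n + 1))]
          exact Finset.single_le_sum (f := fun h => 0 + θ h + τ h)
            (fun h hh => by have := hθ' h hh; have := hτ' h hh; positivity) (by simp)
        linarith
      · rw [hF_zero]; positivity
      · have h1 : 0 ≤ ∑ h ∈ Finset.Icc 1 (n + 1), (0 + τ h) :=
          Finset.sum_nonneg fun h hh => by simpa using hτ' h hh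
        have h2 : 0 ≤ ((n + 1 : ℕ) : ℝ) * γ *
            (T - s + ∑ h ∈ Finset.Icc 1 (n + 1), (0 + τ h)) :=
          mul_nonneg (by positivity) (by linarith)
        have h3 : 0 ≤ ((n + 1 : ℕ) : ℝ) * δ := by positivity
        simp only [Stilde_of_nonpos le_rfl, mul_zero, add_zero, Finset.sum_const_zero, hF_zero]
        linarith
    · have hX : 0 ≤ (j + 1 : ℝ) * τ (n + 1) := by positivity
      obtain ⟨s', hs'0, hs'r, hA1, hA2⟩ := exists_arrival_epoch (A := F n) (B := F (n + 1))
        (hF_mono n) hHr hγ hθn hX hge hδ (hgood (n + 1) hmem j (hθn.trans hge))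
      have hTn : T = T₀ + ∑ k ∈ Finset.Icc 1 n, θ k + θ (n + 1) := by
        rw [hT, Finset.sum_Icc_succ_top (by omega)]; ring
      obtain ⟨s₀, w, hs₀, hs₀s, hw, hlen, hB1, hB2⟩ := ih (by omega) s' hs'0 (by linarith)
      have hFr : F (n + 1) r ≤ F (n + 1) s := hF_mono _ _ _ (hθn.trans hge) hrs
      have hsum : ∀ f : ℕ → ℝ → ℝ,
          ∑ h ∈ Finset.Icc 1 n, f h (Function.update w (n + 1) (r - θ (n + 1) - s') h) =
            ∑ h ∈ Finset.Icc 1 n, f h (w h) := fun f => by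
        refine Finset.sum_congr rfl fun h hh => ?_
        rw [Function.update_of_ne (by simp at hh; omega)]
      refine ⟨s₀, Function.update w (n + 1) (r - θ (n + 1) - s'), hs₀, by linarith, ?_, ?_, ?_, ?_⟩
      · intro h
        rcases eq_or_ne h (n + 1) with rfl | hne
        · simp; linarith
        · rw [Function.update_of_ne hne]; exact hw h
      · rw [Finset.sum_Icc_succ_top (by omega), hsum (fun h x => x + θ h + τ h),
          Function.update_self]
        linarith
      · push_cast; linarith
      · rw [Finset.sum_Icc_succ_top (by omega), Finset.sum_Icc_succ_top (by omega),
          hsum (fun h x => x + τ h),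
          hsum (fun h x => Stilde Hr (C h) (ρ h) γ (θ h)
            (Uconst Hr (C h) (ρ h) γ (Δ h) (θ h) (σ h)) x + (Hr - 1) * γ * x),
          Function.update_self]
        set Y := ∑ h ∈ Finset.Icc 1 n, (w h + τ h) with hY
        have hY0 : 0 ≤ Y := Finset.sum_nonneg fun h hh =>
          add_nonneg (hw h) (hτ' h (by simp at hh ⊢; omega))
        have h1 : (n : ℝ) * γ * (T₀ + ∑ k ∈ Finset.Icc 1 n, θ k - s' + Y) ≤
            n * γ * (T - s + (Y + (r - θ (n + 1) - s' + τ (n + 1)))) :=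
          mul_le_mul_of_nonneg_left (by linarith) (by positivity)
        have h2 : γ * ((j + 1) * τ (n + 1)) ≤
            γ * (T - s + (Y + (r - θ (n + 1) - s' + τ (n + 1)))) :=
          mul_le_mul_of_nonneg_left (by linarith) hγ
        push_cast
        linarith

/-- End-to-end service guarantee along a sample path on which the nodes `1, …, N` meet their
guarantees at grid times and node `N + 1` meets its guarantee at time `t`. -/
theorem network_service_of_good_path {F : ℕ → ℝ → ℝ} {γ t τnet : ℝ} {C ρ Δ σ θ τ : ℕ → ℝ} {N : ℕ}
    (hF_zero : ∀ h, F h 0 = 0) (hF_mono : ∀ h s t, 0 ≤ s → s ≤ t → F h s ≤ F h t)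
    (hγ : 0 ≤ γ) (hρ : ∀ h ∈ Finset.Icc 1 (N + 1), 0 ≤ ρ h)
    (hγH : ∀ h ∈ Finset.Icc 1 (N + 1), ((N + 1 : ℕ) : ℝ) * γ < C h - ρ h)
    (hθ : ∀ h ∈ Finset.Icc 1 (N + 1), 0 ≤ θ h)
    (hU : ∀ h ∈ Finset.Icc 1 (N + 1),
      0 ≤ Uconst ((N + 1 : ℕ) : ℝ) (C h) (ρ h) γ (Δ h) (θ h) (σ h))
    (hτ : ∀ h ∈ Finset.Icc 1 N, 0 < τ h) (hτnet : 0 < τnet)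
    (hτsum : ∑ h ∈ Finset.Icc 1 N, τ h ≤ τnet) (ht : 0 ≤ t)
    (hgood : ∀ h ∈ Finset.Icc 1 N, ∀ j : ℕ,
      0 ≤ t - ∑ k ∈ Finset.Icc 1 (N + 1), θ k + ∑ k ∈ Finset.Icc 1 h, θ k - (j + 1) * τ h →
      (⨅ s : Icc (0 : ℝ)
          (t - ∑ k ∈ Finset.Icc 1 (N + 1), θ k + ∑ k ∈ Finset.Icc 1 h, θ k - (j + 1) * τ h),
        (F (h - 1) ↑s + Sdelta (C h) (ρ h) γ (Δ h) (θ h)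
          (t - ∑ k ∈ Finset.Icc 1 (N + 1), θ k + ∑ k ∈ Finset.Icc 1 h, θ k - (j + 1) * τ h - ↑s)
          (σ h + γ * ((j + 1) * τ h)))) ≤
        F h (t - ∑ k ∈ Finset.Icc 1 (N + 1), θ k + ∑ k ∈ Finset.Icc 1 h, θ k - (j + 1) * τ h))
    (hlast : (⨅ s : Icc (0 : ℝ) t, (F N ↑s + Sdelta (C (N + 1)) (ρ (N + 1)) γ (Δ (N + 1))
        (θ (N + 1)) (t - ↑s) (σ (N + 1)))) ≤ F (N + 1) t)
    (hne : (Finset.Icc 1 (N + 1)).Nonempty) :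
    (⨅ s : Icc (0:ℝ) t, (F 0 ↑s +
        (if τnet + ∑ h ∈ Finset.Icc 1 (N + 1), θ h < t - ↑s then
          max (((Finset.Icc 1 (N + 1)).inf' hne (fun h =>
                Stilde ((N + 1 : ℕ) : ℝ) (C h) (ρ h) γ (θ h)
                  (Uconst ((N + 1 : ℕ) : ℝ) (C h) (ρ h) γ (Δ h) (θ h) (σ h))
                  (t - ↑s - (τnet + ∑ h' ∈ Finset.Icc 1 (N + 1), θ h')))) -
              (((N + 1 : ℕ) : ℝ) - 1) * γ * τnet) 0
        else 0))) ≤ F (N + 1) t := by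
  have hF_nonneg : ∀ h s, 0 ≤ s → 0 ≤ F h s := fun h s hs => by
    simpa [hF_zero] using hF_mono h 0 s le_rfl hs
  have hbdd : BddBelow (range fun s : Icc (0:ℝ) t => (F 0 ↑s +
        (if τnet + ∑ h ∈ Finset.Icc 1 (N + 1), θ h < t - ↑s then
          max (((Finset.Icc 1 (N + 1)).inf' hne (fun h =>
                Stilde ((N + 1 : ℕ) : ℝ) (C h) (ρ h) γ (θ h)
                  (Uconst ((N + 1 : ℕ) : ℝ) (C h) (ρ h) γ (Δ h) (θ h) (σ h))
                  (t - ↑s - (τnet + ∑ h' ∈ Finset.Icc 1 (N + 1), θ h')))) -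
              (((N + 1 : ℕ) : ℝ) - 1) * γ * τnet) 0
        else 0))) := by
    refine ⟨0, ?_⟩
    rintro _ ⟨s, rfl⟩
    have := hF_nonneg 0 s s.2.1
    dsimp only
    split_ifs
    · exact add_nonneg this (le_max_right _ _)
    · simpa using this
  have hlast_mem : N + 1 ∈ Finset.Icc 1 (N + 1) := by simp
  have hsplit : ∀ f : ℕ → ℝ,
      ∑ h ∈ Finset.Icc 1 (N + 1), f h = ∑ h ∈ Finset.Icc 1 N, f h + f (N + 1) := fun f =>
    Finset.sum_Icc_succ_top (by omega) f
  have hHr : (1 : ℝ) ≤ ((N + 1 : ℕ) : ℝ) := by exact_mod_cast Nat.le_add_left 1 N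
  have hθN : ∀ h ∈ Finset.Icc 1 N, 0 ≤ θ h := fun h hh => hθ h (by simp at hh ⊢; omega)
  rcases lt_or_ge t (θ (N + 1)) with hlt | hge
  · refine (ciInf_le hbdd ⟨0, le_rfl, ht⟩).trans ?_
    have h1 : 0 ≤ ∑ h ∈ Finset.Icc 1 N, θ h := Finset.sum_nonneg hθN
    have h2 := hsplit θ
    rw [if_neg (by dsimp only; linarith)]
    simpa [hF_zero] using hF_nonneg (N + 1) t ht
  refine le_of_forall_pos_le_add fun ε hε => ?_
  set δ := ε / ((N + 1 : ℕ) : ℝ) with hδdef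
  have hδ : 0 < δ := by positivity
  have hδε : ((N : ℝ) + 1) * δ = ε := by rw [hδdef]; push_cast; field_simp
  obtain ⟨s', hs'0, hs't, hA1, hA2⟩ := exists_arrival_epoch (A := F N) (B := F (N + 1)) (X := 0)
    (hF_mono N) hHr hγ (hθ _ hlast_mem) le_rfl hge hδ (by simpa using hlast)
  obtain ⟨s₀, w, hs₀, hs₀s, hw, hlen, hB1, hB2⟩ := exists_chained_epoch hF_zero hF_mono hHr hγ hδ
    hθN hτ hgood N le_rfl s' hs'0 (by rw [hsplit]; linarith)
  have hθ0 := hθ _ hlast_mem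
  refine (ciInf_le hbdd ⟨s₀, hs₀, by linarith⟩).trans ?_
  dsimp only
  split_ifs with hif
  swap
  · linarith
  rw [← max_add_add_left, max_le_iff]
  refine ⟨?_, by linarith⟩
  set w' := Function.update w (N + 1) (t - θ (N + 1) - s') with hw'
  have hw'last : w' (N + 1) = t - θ (N + 1) - s' := by simp [hw']
  have hw'eq : ∀ h ∈ Finset.Icc 1 N, w' h = w h := fun h hh => by
    rw [hw', Function.update_of_ne (by simp at hh; omega)]
  have hsum : ∀ f : ℕ → ℝ → ℝ,
      ∑ h ∈ Finset.Icc 1 N, f h (w' h) = ∑ h ∈ Finset.Icc 1 N, f h (w h) := fun f =>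
    Finset.sum_congr rfl fun h hh => by rw [hw'eq h hh]
  have hw'0 : ∀ h ∈ Finset.Icc 1 (N + 1), 0 ≤ w' h := fun h _ => by
    rcases eq_or_ne h (N + 1) with rfl | hne
    · rw [hw'last]; linarith
    · rw [hw', Function.update_of_ne hne]; exact hw h
  have hW := hsum (fun _ x => x)
  simp only [Finset.sum_add_distrib, ← Finset.mul_sum] at hlen hB2
  have hkey := inf'_Stilde_le_sum hne (Hr := ((N + 1 : ℕ) : ℝ)) (γ := γ) (C := C) (ρ := ρ) (θ := θ)
    (U := fun h => Uconst ((N + 1 : ℕ) : ℝ) (C h) (ρ h) γ (Δ h) (θ h) (σ h)) (w := w')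
    (v := t - s₀ - (τnet + ∑ h' ∈ Finset.Icc 1 (N + 1), θ h'))
    (fun h hh => by have := hγH h hh; have := hρ h hh; linarith)
    (fun h hh => by have := hγH h hh; linarith) hθ hU hw'0 (by linarith)
    (by rw [hsplit w', hw'last, hW, hsplit θ]; linarith)
  rw [hsplit (fun h => Stilde _ _ _ _ _ _ (w' h)), hw'last,
    hsum (fun h x => Stilde ((N + 1 : ℕ) : ℝ) (C h) (ρ h) γ (θ h)
      (Uconst ((N + 1 : ℕ) : ℝ) (C h) (ρ h) γ (Δ h) (θ h) (σ h)) x)] at hkey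
  have hTs : t - ∑ k ∈ Finset.Icc 1 (N + 1), θ k + ∑ k ∈ Finset.Icc 1 N, θ k - s' =
      t - θ (N + 1) - s' := by rw [hsplit θ]; ring
  rw [hTs] at hB2
  have hτmul : (N : ℝ) * γ * ∑ h ∈ Finset.Icc 1 N, τ h ≤ N * γ * τnet :=
    mul_le_mul_of_nonneg_left hτsum (by positivity)
  push_cast at hkey hA2 hB2 ⊢
  linarith

theorem tsum_exp_neg_mul_succ_le {x : ℝ} (hx : 0 < x) :
    Summable (fun j : ℕ => Real.exp (-x * (j + 1))) ∧
      ∑' j : ℕ, Real.exp (-x * (j + 1)) ≤ 1 / x := by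
  have hq1 : Real.exp (-x) < 1 := by simpa using hx
  have hterm : (fun j : ℕ => Real.exp (-x * (j + 1))) =
      fun j : ℕ => Real.exp (-x) * Real.exp (-x) ^ j := by
    funext j
    rw [← Real.exp_nat_mul, ← Real.exp_add]
    ring_nf
  rw [hterm]
  refine ⟨(summable_geometric_of_lt_one (Real.exp_nonneg _) hq1).mul_left _, ?_⟩
  rw [tsum_mul_left, tsum_geometric_of_lt_one (Real.exp_nonneg _) hq1, ← div_eq_mul_inv,
    div_le_div_iff₀ (by linarith) hx]
  have h1 : Real.exp (-x) * Real.exp x = 1 := by rw [← Real.exp_add]; simp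
  nlinarith [Real.add_one_le_exp x, Real.exp_pos (-x)]

/-- Union bound over a time grid for exponentially decaying violation probabilities. -/
theorem measure_iUnion_le_of_exp_decay {Ω : Type*} [MeasurableSpace Ω] (P : Measure Ω)
    {E : ℕ → Set Ω} {K α σ g : ℝ} (hK : 0 ≤ K) (hαg : 0 < α * g)
    (hE : ∀ j : ℕ, P (E j) ≤ ENNReal.ofReal (K * Real.exp (-α * (σ + (j + 1) * g)))) :
    P (⋃ j, E j) ≤ ENNReal.ofReal (1 / (α * g) * (K * Real.exp (-α * σ))) := by
  obtain ⟨hsum, hle⟩ := tsum_exp_neg_mul_succ_le hαg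
  have hterm : ∀ j : ℕ, K * Real.exp (-α * (σ + (j + 1) * g)) =
      K * Real.exp (-α * σ) * Real.exp (-(α * g) * (j + 1)) := fun j => by
    rw [mul_assoc, ← Real.exp_add]
    ring_nf
  simp only [hterm] at hE
  calc P (⋃ j, E j) ≤ ∑' j, P (E j) := measure_iUnion_le _
    _ ≤ ∑' j : ℕ, ENNReal.ofReal (K * Real.exp (-α * σ) * Real.exp (-(α * g) * (j + 1))) :=
        ENNReal.tsum_le_tsum hE
    _ = ENNReal.ofReal (∑' j : ℕ, K * Real.exp (-α * σ) * Real.exp (-(α * g) * (j + 1))) :=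
        (ENNReal.ofReal_tsum_of_nonneg (fun j => by positivity) (hsum.mul_left _)).symm
    _ ≤ _ := by
        refine ENNReal.ofReal_le_ofReal ?_
        rw [tsum_mul_left, mul_comm]
        exact mul_le_mul_of_nonneg_right hle (by positivity)

/-- Network service curve for a path of `H ≥ 2` Δ-schedulers with EBB cross
traffic (Eq. (21)). `D 0 = A_1` is the arrival process of the through flow to
node 1 and `D h` is the departure of node `h` (and arrival to node `h+1`). -/
theorem delta_scheduler_network_service_curve
    {Ω : Type*} [MeasurableSpace Ω] (P : Measure Ω) [IsProbabilityMeasure P]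
    (H : ℕ) (hH : 2 ≤ H)
    (D : ℕ → Ω → ℝ → ℝ)
    (hD_zero : ∀ h ω, D h ω 0 = 0)
    (hD_mono : ∀ h ω s t, 0 ≤ s → s ≤ t → D h ω s ≤ D h ω t)
    (hD_nonneg : ∀ h ω t, 0 ≤ t → 0 ≤ D h ω t)
    (hD_le : ∀ h ∈ Finset.Icc 1 H, ∀ ω, ∀ t : ℝ, 0 ≤ t → D h ω t ≤ D (h - 1) ω t)
    (C ρ α M Δ : ℕ → ℝ) (γ : ℝ)
    (hC : ∀ h ∈ Finset.Icc 1 H, 0 < C h)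
    (hρ : ∀ h ∈ Finset.Icc 1 H, 0 ≤ ρ h)
    (hα : ∀ h ∈ Finset.Icc 1 H, 0 < α h)
    (hM : ∀ h ∈ Finset.Icc 1 H, 0 ≤ M h)
    (hγ : 0 < γ)
    (hγH : ∀ h ∈ Finset.Icc 1 H, (H : ℝ) * γ < C h - ρ h)
    (hserv : ∀ h ∈ Finset.Icc 1 H, ∀ θ x t : ℝ, 0 ≤ θ → 0 ≤ x → 0 ≤ t →
      P {ω | D h ω t < ⨅ s : Icc (0:ℝ) t,
          (D (h - 1) ω ↑s + Sdelta (C h) (ρ h) γ (Δ h) θ (t - ↑s) x)}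
        ≤ ENNReal.ofReal (M h * Real.exp 1 * (1 + ρ h / γ) * Real.exp (-α h * x)))
    (σ : ℕ → ℝ) (hσ : ∀ h ∈ Finset.Icc 1 H, 0 ≤ σ h)
    (τnet : ℝ) (hτnet : 0 < τnet)
    (θ : ℕ → ℝ) (hθ : ∀ h ∈ Finset.Icc 1 H, 0 ≤ θ h)
    (hU : ∀ h ∈ Finset.Icc 1 H,
      0 ≤ Uconst (H : ℝ) (C h) (ρ h) γ (Δ h) (θ h) (σ h))
    (t : ℝ) (ht : 0 ≤ t) :
    P {ω | D H ω t < ⨅ s : Icc (0:ℝ) t, (D 0 ω ↑s +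
        (if τnet + ∑ h ∈ Finset.Icc 1 H, θ h < t - ↑s then
          max (((Finset.Icc 1 H).inf' (Finset.nonempty_Icc.mpr (by omega)) (fun h =>
                Stilde (H : ℝ) (C h) (ρ h) γ (θ h)
                  (Uconst (H : ℝ) (C h) (ρ h) γ (Δ h) (θ h) (σ h))
                  (t - ↑s - (τnet + ∑ h' ∈ Finset.Icc 1 H, θ h')))) -
              ((H : ℝ) - 1) * γ * τnet) 0
        else 0))}
      ≤ ENNReal.ofReal (M H * Real.exp 1 * (1 + ρ H / γ) * Real.exp (-α H * σ H) +
          ((∑ h ∈ Finset.Ico 1 H, (α h)⁻¹) / (γ * τnet)) *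
            ∑ h ∈ Finset.Ico 1 H,
              M h * Real.exp 1 * (1 + ρ h / γ) * Real.exp (-α h * σ h)) := by
  obtain ⟨N, rfl⟩ : ∃ N, H = N + 1 := ⟨H - 1, by omega⟩
  have hIco : Finset.Ico 1 (N + 1) = Finset.Icc 1 N := by ext; simp
  rw [hIco]
  have hsub : ∀ h ∈ Finset.Icc 1 N, h ∈ Finset.Icc 1 (N + 1) := fun h hh => by
    simp at hh ⊢; omega
  have hlast_mem : N + 1 ∈ Finset.Icc 1 (N + 1) := by simp
  set S := ∑ h ∈ Finset.Icc 1 N, (α h)⁻¹ with hS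
  have hSpos : 0 < S := Finset.sum_pos (fun h hh => inv_pos.mpr (hα h (hsub h hh)))
    ⟨1, by simp; omega⟩
  set τ : ℕ → ℝ := fun h => (α h)⁻¹ / S * τnet with hτdef
  have hτ : ∀ h ∈ Finset.Icc 1 N, 0 < τ h := fun h hh => by
    have := hα h (hsub h hh)
    positivity
  have hτsum : ∑ h ∈ Finset.Icc 1 N, τ h = τnet := by
    rw [hτdef, ← Finset.sum_mul, ← Finset.sum_div, ← hS, div_self hSpos.ne', one_mul]
  set K : ℕ → ℝ := fun h => M h * Real.exp 1 * (1 + ρ h / γ) with hKdef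
  have hK : ∀ h ∈ Finset.Icc 1 (N + 1), 0 ≤ K h := fun h hh => by
    have := hM h hh
    have := hρ h hh
    positivity
  set r : ℕ → ℕ → ℝ := fun h j =>
    t - ∑ k ∈ Finset.Icc 1 (N + 1), θ k + ∑ k ∈ Finset.Icc 1 h, θ k - (j + 1) * τ h with hr
  set E : ℕ → ℕ → Set Ω := fun h j => {ω | 0 ≤ r h j ∧ D h ω (r h j) <
    ⨅ s : Icc (0:ℝ) (r h j), (D (h - 1) ω ↑s +
      Sdelta (C h) (ρ h) γ (Δ h) (θ h) (r h j - ↑s) (σ h + γ * ((j + 1) * τ h)))} with hE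
  set E₀ : Set Ω := {ω | D (N + 1) ω t < ⨅ s : Icc (0:ℝ) t, (D N ω ↑s +
    Sdelta (C (N + 1)) (ρ (N + 1)) γ (Δ (N + 1)) (θ (N + 1)) (t - ↑s) (σ (N + 1)))} with hE₀
  have hcover : {ω | D (N + 1) ω t < ⨅ s : Icc (0:ℝ) t, (D 0 ω ↑s +
        (if τnet + ∑ h ∈ Finset.Icc 1 (N + 1), θ h < t - ↑s then
          max (((Finset.Icc 1 (N + 1)).inf' (Finset.nonempty_Icc.mpr (by omega)) (fun h =>
                Stilde ((N + 1 : ℕ) : ℝ) (C h) (ρ h) γ (θ h)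
                  (Uconst ((N + 1 : ℕ) : ℝ) (C h) (ρ h) γ (Δ h) (θ h) (σ h))
                  (t - ↑s - (τnet + ∑ h' ∈ Finset.Icc 1 (N + 1), θ h')))) -
              (((N + 1 : ℕ) : ℝ) - 1) * γ * τnet) 0
        else 0))} ⊆ E₀ ∪ ⋃ h ∈ Finset.Icc 1 N, ⋃ j, E h j := by
    intro ω hω
    by_contra hcon
    simp only [mem_union, mem_iUnion, not_or, not_exists] at hcon
    obtain ⟨hc0, hc⟩ := hcon
    refine not_lt.mpr ?_ (mem_ofPred.mp hω)
    refine network_service_of_good_path (F := fun h => D h ω) (τ := τ) (fun h => hD_zero h ω)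
      (fun h => hD_mono h ω) hγ.le hρ hγH hθ hU hτ hτnet hτsum.le ht ?_ (not_lt.mp hc0) _
    intro h hh j hj
    by_contra hlt
    exact hc h hh j ⟨hj, not_le.mp hlt⟩
  have hE_le : ∀ h ∈ Finset.Icc 1 N, P (⋃ j, E h j) ≤
      ENNReal.ofReal (S / (γ * τnet) * (K h * Real.exp (-α h * σ h))) := fun h hh => by
    have hαh := hα h (hsub h hh)
    have hτh := hτ h hh
    have hrate : 1 / (α h * (γ * τ h)) = S / (γ * τnet) := by
      rw [hτdef]
      field_simp
    rw [← hrate]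
    refine measure_iUnion_le_of_exp_decay P (hK h (hsub h hh)) (by positivity) fun j => ?_
    by_cases hj : 0 ≤ r h j
    · have hσh := hσ h (hsub h hh)
      refine (measure_mono fun ω hω => hω.2).trans ((hserv h (hsub h hh) (θ h)
        (σ h + γ * ((j + 1) * τ h)) (r h j) (hθ h (hsub h hh)) (by positivity) hj).trans_eq ?_)
      rw [show σ h + γ * ((j + 1) * τ h) = σ h + (j + 1) * (γ * τ h) by ring]
    · simp [hE, hj]
  have hcoef : 0 ≤ S / (γ * τnet) := by positivity
  have hterm : ∀ h ∈ Finset.Icc 1 N,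
      0 ≤ S / (γ * τnet) * (K h * Real.exp (-α h * σ h)) := fun h hh =>
    mul_nonneg hcoef (mul_nonneg (hK h (hsub h hh)) (Real.exp_nonneg _))
  calc _ ≤ P (E₀ ∪ ⋃ h ∈ Finset.Icc 1 N, ⋃ j, E h j) := measure_mono hcover
    _ ≤ P E₀ + ∑ h ∈ Finset.Icc 1 N, P (⋃ j, E h j) :=
        (measure_union_le _ _).trans (add_le_add_right (measure_biUnion_finset_le _ _) _)
    _ ≤ ENNReal.ofReal (K (N + 1) * Real.exp (-α (N + 1) * σ (N + 1))) +
          ∑ h ∈ Finset.Icc 1 N,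
            ENNReal.ofReal (S / (γ * τnet) * (K h * Real.exp (-α h * σ h))) :=
        add_le_add (hserv (N + 1) hlast_mem (θ (N + 1)) (σ (N + 1)) t (hθ _ hlast_mem)
          (hσ _ hlast_mem) ht) (Finset.sum_le_sum hE_le)
    _ = _ := by
        rw [← ENNReal.ofReal_sum_of_nonneg hterm, ← ENNReal.ofReal_add
          (mul_nonneg (hK _ hlast_mem) (Real.exp_nonneg _)) (Finset.sum_nonneg hterm),
          ← Finset.mul_sum]
end

section
/- (Deconvolution bound for the backlog, Eq. (25).) Let ρ, σ_0, c, a ≥ 0 and let S̃: [0,∞) → [0,∞) be nondecreasing, concave on (0,∞), with S̃(0) = 0. Suppose there exists T > a such that ρ t + σ_0 + c ≤ S̃(t − a) for all t ≥ T. Define G(t) := ρ t + σ_0 for t > 0 and G(t) := 0 for t ≤ 0, and S(t) := [S̃(t − a) − c]_+ for t > a and S(t) := 0 for t ≤ a. Then sup_{t ≥ 0} { G(t) − S(t) } ≤ ρ a + σ_0 + c. -/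
open Set

/-- A nonnegative concave function on `(0,∞)` that lies above the line `u ↦ r * u` at `y` lies above
it on all of `(0, y)`. -/
theorem ConcaveOn.mul_le_of_mul_le_of_nonneg {f : ℝ → ℝ} (hf : ConcaveOn ℝ (Ioi 0) f)
    (hf_nonneg : ∀ u, 0 < u → 0 ≤ f u) {r x y : ℝ} (hx : 0 < x) (hxy : x < y)
    (hy : r * y ≤ f y) : r * x ≤ f x := by
  have hy0 : 0 < y := hx.trans hxy
  have key : ∀ ε ∈ Ioo 0 x, (x - ε) * (r * y) ≤ (y - ε) * f x := by
    rintro ε ⟨hε, hεx⟩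
    have hslope := hf.slope_anti_adjacent (mem_Ioi.2 hε) (mem_Ioi.2 hy0) hεx hxy
    rw [div_le_div_iff₀ (by linarith) (by linarith)] at hslope
    have h₁ := mul_le_mul_of_nonneg_left hy (sub_nonneg.2 hεx.le)
    have h₂ := mul_nonneg (sub_nonneg.2 hxy.le) (hf_nonneg ε hε)
    linarith
  have hlim : (x - 0) * (r * y) ≤ (y - 0) * f x := by
    refine ContinuousWithinAt.closure_le (s := Ioo 0 x) (f := fun ε => (x - ε) * (r * y))
      (g := fun ε => (y - ε) * f x) ?_ ?_ ?_ key
    · rw [closure_Ioo hx.ne]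
      exact left_mem_Icc.2 hx.le
    · fun_prop
    · fun_prop
  refine le_of_mul_le_mul_left ?_ hy0
  linarith

/-- Deconvolution bound for the backlog (Eq. (25)): with `G(t) = ρt + σ_0` for
`t > 0` (else `0`) and `S(t) = [S̃(t−a) − c]_+` for `t > a` (else `0`), where
`S̃` is nondecreasing, concave on `(0,∞)` with `S̃(0) = 0`, and eventually
dominates `ρt + σ_0 + c`, the deconvolution `(G ⊘ S)(0) = sup_{t≥0}{G(t)−S(t)}`
is at most `ρa + σ_0 + c`. -/
theorem deconvolution_backlog_bound
    (ρ σ0 c a : ℝ) (hρ : 0 ≤ ρ) (hσ0 : 0 ≤ σ0) (hc : 0 ≤ c) (ha : 0 ≤ a)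
    (St : ℝ → ℝ)
    (hS0 : St 0 = 0)
    (hS_mono : ∀ u v : ℝ, 0 ≤ u → u ≤ v → St u ≤ St v)
    (hS_nonneg : ∀ u : ℝ, 0 ≤ u → 0 ≤ St u)
    (hS_conc : ConcaveOn ℝ (Ioi 0) St)
    (T : ℝ) (hT : a < T)
    (hdom : ∀ t : ℝ, T ≤ t → ρ * t + σ0 + c ≤ St (t - a)) :
    (⨆ t : Ici (0:ℝ),
        ((if (t : ℝ) ≤ 0 then 0 else ρ * ↑t + σ0) -
          (if (t : ℝ) ≤ a then 0 else max (St (↑t - a) - c) 0)))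
      ≤ ρ * a + σ0 + c := by
  have hline : ∀ x, 0 < x → ρ * x ≤ St x := by
    intro x hx
    have hy : x < max (x + 1) (T - a) := lt_max_of_lt_left (lt_add_one x)
    refine hS_conc.mul_le_of_mul_le_of_nonneg (fun u hu => hS_nonneg u hu.le) hx hy ?_
    have h := hdom (max (x + 1) (T - a) + a) (by linarith [le_max_right (x + 1) (T - a)])
    rw [add_sub_cancel_right] at h
    linarith [mul_nonneg hρ ha]
  have : Nonempty (Ici (0 : ℝ)) := ⟨⟨0, self_mem_Ici⟩⟩
  refine ciSup_le fun ⟨t, ht⟩ => ?_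
  have hρa : 0 ≤ ρ * a := mul_nonneg hρ ha
  dsimp only
  split_ifs with h₀ h₁ h₁
  · linarith
  · exact absurd (h₀.trans ha) h₁
  · linarith [mul_le_mul_of_nonneg_left h₁ hρ]
  · linarith [hline (t - a) (by linarith), le_max_left (St (t - a) - c) 0]
end

section
/- (Gap between the upper-bound latency θ* and the lower-bound latency L.) Let C > 0, 0 ≤ ρ < C, σ ≥ 0 and Δ ∈ ℝ. Define θ* := min{ σ/(C − ρ), [σ + ρΔ]_+ / C } and L := min{ σ/(C − ρ), [σ + ρ[Δ]_+ − C[Δ]_−]_+ / C }. Then 0 ≤ θ* − L ≤ (1 − ρ/C)·[Δ]_−. In particular θ* = L whenever Δ ≥ 0. -/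
/-- Gap between the upper-bound latency `θ*` and the lower-bound latency `L`:
with `θ* = min{σ/(C−ρ), [σ+ρΔ]_+/C}` and
`L = min{σ/(C−ρ), [σ + ρ[Δ]_+ − C[Δ]_−]_+/C}`, one has
`0 ≤ θ* − L ≤ (1 − ρ/C)[Δ]_−`; in particular `θ* = L` for `Δ ≥ 0`. -/
theorem latency_gap
    (C ρ σ Δ : ℝ) (hC : 0 < C) (hρ0 : 0 ≤ ρ) (hρC : ρ < C) (hσ : 0 ≤ σ) :
    0 ≤ min (σ / (C - ρ)) (max (σ + ρ * Δ) 0 / C) -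
        min (σ / (C - ρ)) (max (σ + ρ * max Δ 0 - C * max (-Δ) 0) 0 / C) ∧
    min (σ / (C - ρ)) (max (σ + ρ * Δ) 0 / C) -
        min (σ / (C - ρ)) (max (σ + ρ * max Δ 0 - C * max (-Δ) 0) 0 / C) ≤
      (1 - ρ / C) * max (-Δ) 0 ∧
    (0 ≤ Δ →
      min (σ / (C - ρ)) (max (σ + ρ * Δ) 0 / C) =
        min (σ / (C - ρ)) (max (σ + ρ * max Δ 0 - C * max (-Δ) 0) 0 / C)) := by
  rcases le_or_gt 0 Δ with hΔ | hΔ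
  · have hneg : max (-Δ) 0 = 0 := max_eq_right (by linarith)
    simp [hneg, max_eq_left hΔ]
  · rw [max_eq_right hΔ.le, max_eq_left (by linarith : (0 : ℝ) ≤ -Δ)]
    have hgap : 0 ≤ (C - ρ) * -Δ := mul_nonneg (by linarith) (by linarith)
    have hle : max (σ + ρ * 0 - C * -Δ) 0 / C ≤ max (σ + ρ * Δ) 0 / C := by
      gcongr ?_ / C
      exact max_le_max (by linarith) le_rfl
    have hfactor : (1 - ρ / C) * -Δ = (C - ρ) * -Δ / C := by field_simp
    have hgap' : 0 ≤ (1 - ρ / C) * -Δ := hfactor ▸ div_nonneg hgap hC.le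
    have hub : max (σ + ρ * Δ) 0 / C ≤
        max (σ + ρ * 0 - C * -Δ) 0 / C + (1 - ρ / C) * -Δ := by
      rw [hfactor, ← add_div]
      gcongr ?_ / C
      refine max_le ?_ (add_nonneg (le_max_right _ _) hgap)
      linarith [le_max_left (σ + ρ * 0 - C * -Δ) 0]
    refine ⟨sub_nonneg.2 (min_le_min le_rfl hle), ?_, fun h => absurd h hΔ.not_ge⟩
    rw [sub_le_iff_le_add, ← min_add_add_left]
    exact min_le_min (by linarith) (by linarith)
end

section
/- (Deterministic end-to-end backlog bound, Eq. (28).) Consider nondecreasing functions A_0 = A_1, D_1, …, D_H: [0,∞) → [0,∞) vanishing at 0 with D_h ≤ A_h and A_{h+1} := D_h for h = 1, …, H. Let C_h > 0, ρ_h ≥ 0, σ_h ≥ 0, Δ^h ∈ ℝ with Δ^h(θ) := min{θ, Δ^h} (1 ≤ h ≤ H), and let ρ_0, σ_0 ≥ 0 satisfy the stability condition ρ_0 < min_{1≤h≤H}(C_h − ρ_h). Assume: (i) A_0(t) − A_0(s) ≤ ρ_0 (t − s) + σ_0 for all 0 ≤ s ≤ t; (ii) for every h and every θ ≥ 0, D_h(t)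 ≥ inf_{0 ≤ s ≤ t} { A_h(s) + S_h^θ(t−s) } for all t ≥ 0, where S_h^θ(u) := [ C_h u − [ ρ_h (u − θ + Δ^h(θ)) + σ_h ]_+ ]_+·1_{u > θ}. Then for all t ≥ 0: A_0(t) − D_H(t) ≤ σ_0 + ρ_0 Σ_{h=1}^H θ*_h, where θ*_h := min{ σ_h/(C_h − ρ_h), [σ_h + ρ_h Δ^h]_+ / C_h }. -/
open Set

/-- The deterministic service curve of a Δ-scheduler (γ = 0):
`S^θ(u) = [C u − [ρ(u − θ + Δ(θ)) + σ]_+]_+ · 1_{u > θ}` with `Δ(θ) = min{θ,Δ}`. -/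
noncomputable def SdeltaDet (C ρ Δ θ σ u : ℝ) : ℝ :=
  if u ≤ θ then 0 else max (C * u - max (ρ * (u - θ + min θ Δ) + σ) 0) 0

theorem mul_sub_div_le_SdeltaDet_zero {C ρ Δ σ r u : ℝ} (hρ : 0 ≤ ρ) (hσ : 0 ≤ σ) (hr : 0 ≤ r)
    (hrC : r < C - ρ) (hu : 0 ≤ u) : r * (u - σ / (C - ρ)) ≤ SdeltaDet C ρ Δ 0 σ u := by
  have hCρ : 0 < C - ρ := hr.trans_lt hrC
  have hq : 0 ≤ σ / (C - ρ) := div_nonneg hσ hCρ.le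
  unfold SdeltaDet
  split_ifs with h
  · exact mul_nonpos_of_nonneg_of_nonpos hr (by linarith)
  · rcases le_total u (σ / (C - ρ)) with h1 | h1
    · exact le_max_of_le_right (mul_nonpos_of_nonneg_of_nonpos hr (by linarith))
    · have hm : ρ * min 0 Δ ≤ 0 := mul_nonpos_of_nonneg_of_nonpos hρ (min_le_left _ _)
      have hb : max (ρ * (u - 0 + min 0 Δ) + σ) 0 ≤ ρ * u + σ :=
        max_le (by linarith) (by positivity)
      have hcancel : (C - ρ) * (σ / (C - ρ)) = σ := mul_div_cancel₀ _ hCρ.ne'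
      have hle := mul_le_mul_of_nonneg_right hrC.le (sub_nonneg.mpr h1)
      exact le_max_of_le_left (by linarith)

theorem mul_sub_le_SdeltaDet {C ρ Δ σ r u : ℝ} (hρ : 0 ≤ ρ) (hr : 0 ≤ r) (hrC : r < C - ρ) :
    r * (u - max (σ + ρ * Δ) 0 / C) ≤ SdeltaDet C ρ Δ (max (σ + ρ * Δ) 0 / C) σ u := by
  have hC : 0 < C := by linarith
  have hcancel : C * (max (σ + ρ * Δ) 0 / C) = max (σ + ρ * Δ) 0 := mul_div_cancel₀ _ hC.ne'
  have hmax := le_max_left (σ + ρ * Δ) 0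
  have hmax0 := le_max_right (σ + ρ * Δ) 0
  generalize max (σ + ρ * Δ) 0 / C = θ at *
  unfold SdeltaDet
  split_ifs with h
  · exact mul_nonpos_of_nonneg_of_nonpos hr (by linarith)
  · have hu : 0 ≤ u - θ := by linarith
    have hm : ρ * min θ Δ ≤ ρ * Δ := mul_le_mul_of_nonneg_left (min_le_right _ _) hρ
    have hρu : 0 ≤ ρ * (u - θ) := mul_nonneg hρ hu
    have hb : max (ρ * (u - θ + min θ Δ) + σ) 0 ≤ ρ * (u - θ) + C * θ :=
      max_le (by linarith) (by linarith)
    have hle := mul_le_mul_of_nonneg_right hrC.le hu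
    exact le_max_of_le_left (by linarith)

/-- For a suitable `θ`, the service curve dominates a rate-latency curve with latency `θ*`. -/
theorem exists_mul_sub_le_SdeltaDet {C ρ Δ σ r : ℝ} (hρ : 0 ≤ ρ) (hσ : 0 ≤ σ) (hr : 0 ≤ r)
    (hrC : r < C - ρ) : ∃ θ, 0 ≤ θ ∧ ∀ u, 0 ≤ u →
      r * (u - min (σ / (C - ρ)) (max (σ + ρ * Δ) 0 / C)) ≤ SdeltaDet C ρ Δ θ σ u := by
  rcases le_total (σ / (C - ρ)) (max (σ + ρ * Δ) 0 / C) with h | h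
  · rw [min_eq_left h]
    exact ⟨0, le_rfl, fun _ hu => mul_sub_div_le_SdeltaDet_zero hρ hσ hr hrC hu⟩
  · rw [min_eq_right h]
    exact ⟨_, div_nonneg (le_max_right _ _) (by linarith),
      fun _ _ => mul_sub_le_SdeltaDet hρ hr hrC⟩

/-- Deterministic end-to-end backlog bound (Eq. (28)): `D 0 = A_0` is the
through-flow arrival, `D h` the departure of node `h` (arrival to node `h+1`),
each node offering for every `θ ≥ 0` the deterministic Δ-scheduler service curve.
Then the end-to-end backlog is at most `σ_0 + ρ_0 Σ_{h=1}^H θ*_h`, where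
`θ*_h = min{σ_h/(C_h − ρ_h), [σ_h + ρ_h Δ^h]_+/C_h}`. -/
theorem deterministic_backlog_bound
    (H : ℕ) (hH : 1 ≤ H)
    (D : ℕ → ℝ → ℝ)
    (hD_zero : ∀ h, D h 0 = 0)
    (hD_mono : ∀ h, ∀ s t : ℝ, 0 ≤ s → s ≤ t → D h s ≤ D h t)
    (hD_nonneg : ∀ h, ∀ t : ℝ, 0 ≤ t → 0 ≤ D h t)
    (hD_le : ∀ h ∈ Finset.Icc 1 H, ∀ t : ℝ, 0 ≤ t → D h t ≤ D (h - 1) t)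
    (C ρ σ Δ : ℕ → ℝ)
    (hC : ∀ h ∈ Finset.Icc 1 H, 0 < C h)
    (hρ : ∀ h ∈ Finset.Icc 1 H, 0 ≤ ρ h)
    (hσ : ∀ h ∈ Finset.Icc 1 H, 0 ≤ σ h)
    (hρ0 : 0 ≤ ρ 0) (hσ0 : 0 ≤ σ 0)
    (hstab : ∀ h ∈ Finset.Icc 1 H, ρ 0 < C h - ρ h)
    (henv : ∀ s t : ℝ, 0 ≤ s → s ≤ t → D 0 t - D 0 s ≤ ρ 0 * (t - s) + σ 0)
    (hserv : ∀ h ∈ Finset.Icc 1 H, ∀ θ : ℝ, 0 ≤ θ → ∀ t : ℝ, 0 ≤ t →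
      (⨅ s : Icc (0:ℝ) t, (D (h - 1) ↑s + SdeltaDet (C h) (ρ h) (Δ h) θ (σ h) (t - ↑s)))
        ≤ D h t)
    (t : ℝ) (ht : 0 ≤ t) :
    D 0 t - D H t ≤ σ 0 + ρ 0 * ∑ h ∈ Finset.Icc 1 H,
      min (σ h / (C h - ρ h)) (max (σ h + ρ h * Δ h) 0 / C h) := by
  have key : ∀ n ≤ H, ∀ s T : ℝ, 0 ≤ s → s ≤ T →
      D 0 T - D n s ≤ ρ 0 * (T - s) + σ 0 + ρ 0 * ∑ h ∈ Finset.Icc 1 n,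
        min (σ h / (C h - ρ h)) (max (σ h + ρ h * Δ h) 0 / C h) := by
    intro n
    induction n with
    | zero => intro _ s T hs hsT; simpa using henv s T hs hsT
    | succ n ih =>
      intro hn s T hs hsT
      have hmem : n + 1 ∈ Finset.Icc 1 H := Finset.mem_Icc.mpr ⟨by omega, hn⟩
      obtain ⟨θ, hθ, hS⟩ := exists_mul_sub_le_SdeltaDet (Δ := Δ (n + 1)) (hρ _ hmem)
        (hσ _ hmem) hρ0 (hstab _ hmem)
      have hinf := hserv _ hmem θ hθ s hs
      rw [Finset.sum_Icc_succ_top (by omega)]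
      rw [Nat.add_sub_cancel] at hinf
      have : Nonempty (Icc (0 : ℝ) s) := ⟨⟨0, le_rfl, hs⟩⟩
      rw [sub_le_comm]
      refine le_trans (le_ciInf fun x => ?_) hinf
      have hprev := ih (by omega) x T x.2.1 (x.2.2.trans hsT)
      have hcurve := hS (s - x) (sub_nonneg.mpr x.2.2)
      linarith
  simpa using key H le_rfl t t ht le_rfl
end

section
/- (Deterministic end-to-end delay bound, Eq. (29).) Consider nondecreasing functions A_0 = A_1, D_1, …, D_H: [0,∞) → [0,∞) vanishing at 0 with D_h ≤ A_h and A_{h+1} := D_h for h = 1, …, H. Let C_h > 0, ρ_h ≥ 0, σ_h ≥ 0, Δ^h ∈ ℝ with Δ^h(θ) := min{θ, Δ^h} (1 ≤ h ≤ H), and let ρ_0, σ_0 ≥ 0 satisfy ρ_0 < min_{1≤h≤H}(C_h − ρ_h). Assume: (i) A_0(t) − A_0(s) ≤ ρ_0 (t − s) + σ_0 for all 0 ≤ s ≤ t; (ii) for every h and every θ ≥ 0, D_h(t) ≥ inf_{0 ≤ s ≤ t} { A_h(s) + S_h^θ(t−s) } for all t ≥ 0, where S_h^θ(u) := [ C_h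 u − [ ρ_h (u − θ + Δ^h(θ)) + σ_h ]_+ ]_+·1_{u > θ}. Define W_net(t) := inf{ s ≥ 0 : D_H(t+s) ≥ A_0(t) }. Then for all t ≥ 0: W_net(t) ≤ max_{1 ≤ h ≤ H} max{ σ_0 / C_h, (σ_0 − U*_h)/(C_h − ρ_h) } + Σ_{h=1}^H θ*_h, where θ*_h := min{ σ_h/(C_h − ρ_h), [σ_h + ρ_h Δ^h]_+ / C_h } and U*_h := [σ_h + ρ_h Δ^h]_−. -/
open Set

/-- The minimum of finitely many affine functions, given as pairs (slope, intercept). -/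
noncomputable def minAffine (L : Finset (ℝ × ℝ)) (hL : L.Nonempty) (v : ℝ) : ℝ :=
  L.inf' hL fun p => p.1 * v + p.2

lemma minAffine_le {L : Finset (ℝ × ℝ)} (hL : L.Nonempty) {p : ℝ × ℝ} (hp : p ∈ L) (v : ℝ) :
    minAffine L hL v ≤ p.1 * v + p.2 :=
  Finset.inf'_le (fun p : ℝ × ℝ => p.1 * v + p.2) hp

lemma exists_minAffine_eq {L : Finset (ℝ × ℝ)} (hL : L.Nonempty) (v : ℝ) :
    ∃ p ∈ L, minAffine L hL v = p.1 * v + p.2 :=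
  Finset.exists_mem_eq_inf' hL fun p : ℝ × ℝ => p.1 * v + p.2

lemma minAffine_mono {L : Finset (ℝ × ℝ)} (hL : L.Nonempty) (hslope : ∀ p ∈ L, 0 ≤ p.1)
    {x y : ℝ} (hxy : x ≤ y) : minAffine L hL x ≤ minAffine L hL y := by
  obtain ⟨p, hp, hpy⟩ := exists_minAffine_eq hL y
  rw [hpy]
  have := mul_le_mul_of_nonneg_left hxy (hslope p hp)
  linarith [minAffine_le hL hp x]

lemma minAffine_add_le {L : Finset (ℝ × ℝ)} (hL : L.Nonempty) (hintercept : ∀ p ∈ L, 0 ≤ p.2)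
    {x y : ℝ} (hx : 0 ≤ x) (hy : 0 ≤ y) :
    minAffine L hL (x + y) ≤ minAffine L hL x + minAffine L hL y := by
  obtain ⟨p, hp, hpx⟩ := exists_minAffine_eq hL x
  obtain ⟨q, hq, hqy⟩ := exists_minAffine_eq hL y
  rw [hpx, hqy]
  rcases le_total p.1 q.1 with h | h
  · have := mul_le_mul_of_nonneg_right h hy
    linarith [minAffine_le hL hp (x + y), hintercept q hq]
  · have := mul_le_mul_of_nonneg_right h hx
    linarith [minAffine_le hL hq (x + y), hintercept p hp]

/-- Concatenation of nodes: if each node offers a service curve above `u ↦ b [u − θ_h]_+` with a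
common monotone subadditive `b`, the path offers `u ↦ b [u − ∑ θ_h]_+`. -/
lemma le_departure_of_forall_le {H : ℕ} {D S : ℕ → ℝ → ℝ} {θ : ℕ → ℝ} {b : ℝ → ℝ}
    (hmono : Monotone b) (hb0 : b 0 ≤ 0)
    (hsub : ∀ x y, 0 ≤ x → 0 ≤ y → b (x + y) ≤ b x + b y)
    (hS : ∀ h ∈ Finset.Icc 1 H, ∀ u, 0 ≤ u → b (max (u - θ h) 0) ≤ S h u)
    (hserv : ∀ h ∈ Finset.Icc 1 H, ∀ t : ℝ, 0 ≤ t →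
      (⨅ s : Icc (0:ℝ) t, (D (h - 1) ↑s + S h (t - ↑s))) ≤ D h t)
    (k : ℕ) (hk : k ≤ H) (t : ℝ) (ht : 0 ≤ t) (x : ℝ)
    (hx : ∀ s, 0 ≤ s → s ≤ t → x ≤ D 0 s + b (max (t - s - ∑ h ∈ Finset.Icc 1 k, θ h) 0)) :
    x ≤ D k t := by
  induction k generalizing t x with
  | zero =>
    have := hx t ht le_rfl
    simp at this
    linarith
  | succ k ih =>
    have hmem : k + 1 ∈ Finset.Icc 1 H := Finset.mem_Icc.mpr ⟨by omega, hk⟩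
    refine le_trans ?_ (hserv _ hmem t ht)
    have : Nonempty (Icc (0:ℝ) t) := ⟨⟨0, le_rfl, ht⟩⟩
    refine le_ciInf fun ⟨s, hs0, hst⟩ => ?_
    simp only [Nat.add_sub_cancel]
    rw [← sub_le_iff_le_add]
    refine ih (by omega) s hs0 _ fun r hr0 hrs => ?_
    have h1 := hx r hr0 (hrs.trans hst)
    have h2 := hS _ hmem (t - s) (sub_nonneg.mpr hst)
    rw [Finset.sum_Icc_succ_top (by omega)] at h1
    have h3 : b (max (t - r - (∑ h ∈ Finset.Icc 1 k, θ h + θ (k + 1))) 0) ≤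
        b (max (s - r - ∑ h ∈ Finset.Icc 1 k, θ h) 0 + max (t - s - θ (k + 1)) 0) := by
      refine hmono (max_le ?_ (by positivity))
      have h4 := le_max_left (s - r - ∑ h ∈ Finset.Icc 1 k, θ h) 0
      have h5 := le_max_left (t - s - θ (k + 1)) 0
      linarith
    have h6 := hsub (max (s - r - ∑ h ∈ Finset.Icc 1 k, θ h) 0) (max (t - s - θ (k + 1)) 0)
      (le_max_right _ _) (le_max_right _ _)
    linarith

/-- With the delay parameter `θ*`, the Δ-scheduler service curve dominates the delayed concave curve
`v ↦ min (C v) ((C − ρ) v + U*)`. -/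
lemma min_affine_le_SdeltaDet {C ρ σ Δ u : ℝ} (hC : 0 < C) (hρ : 0 ≤ ρ) (hρC : ρ < C)
    (hσ : 0 ≤ σ) :
    let θ := min (σ / (C - ρ)) (max (σ + ρ * Δ) 0 / C)
    min (C * max (u - θ) 0) ((C - ρ) * max (u - θ) 0 + max (-(σ + ρ * Δ)) 0) ≤
      SdeltaDet C ρ Δ θ σ u := by
  intro θ
  have hr : 0 < C - ρ := sub_pos.mpr hρC
  unfold SdeltaDet
  split_ifs with hu
  · rw [max_eq_right (sub_nonpos.mpr hu)]
    simp
  push Not at hu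
  rw [max_eq_left (a := u - θ) (sub_pos.mpr hu).le]
  refine le_max_of_le_left ?_
  have hθdef : θ = min (σ / (C - ρ)) (max (σ + ρ * Δ) 0 / C) := rfl
  have hθ0 : 0 ≤ θ := le_min (div_nonneg hσ hr.le) (div_nonneg (le_max_right _ _) hC.le)
  clear_value θ
  have hCu : 0 ≤ C * θ := mul_nonneg hC.le hθ0
  rcases le_or_gt (σ / (C - ρ)) Δ with hΔ | hΔ
  · have hΔ' := (div_le_iff₀ hr).mp hΔ
    have hΔ0 : 0 ≤ Δ := (div_nonneg hσ hr.le).trans hΔ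
    have hK : 0 ≤ σ + ρ * Δ := add_nonneg hσ (mul_nonneg hρ hΔ0)
    have hle : σ / (C - ρ) ≤ max (σ + ρ * Δ) 0 / C := by
      rw [max_eq_left hK, div_le_div_iff₀ hr hC]
      nlinarith [mul_le_mul_of_nonneg_left hΔ' hρ]
    rw [min_eq_left hle] at hθdef
    have hθr : θ * (C - ρ) = σ := (eq_div_iff hr.ne').mp hθdef
    have hu0 : 0 ≤ ρ * u := mul_nonneg hρ (hθ0.trans hu.le)
    rw [min_eq_left (hθdef.trans_le hΔ), max_eq_right (neg_nonpos.mpr hK), sub_add_cancel,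
      max_eq_left (add_nonneg hu0 hσ)]
    exact (min_le_right _ _).trans (by linarith)
  · have hΔ' := (lt_div_iff₀ hr).mp hΔ
    rcases le_or_gt 0 (σ + ρ * Δ) with hK | hK
    · have hle : (σ + ρ * Δ) / C ≤ σ / (C - ρ) := by
        rw [div_le_div_iff₀ hC hr]
        nlinarith [mul_le_mul_of_nonneg_left hΔ'.le hρ]
      rw [max_eq_left hK, min_eq_right hle] at hθdef
      have hθC : θ * C = σ + ρ * Δ := (eq_div_iff hC.ne').mp hθdef
      have hΔθ : Δ ≤ θ := by
        rw [hθdef, le_div_iff₀ hC]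
        linarith
      have hu0 : 0 ≤ ρ * (u - θ) := mul_nonneg hρ (sub_pos.mpr hu).le
      rw [min_eq_right hΔθ, max_eq_right (neg_nonpos.mpr hK), max_eq_left (by linarith)]
      exact (min_le_right _ _).trans (by linarith)
    · rw [max_eq_right hK.le, zero_div, min_eq_right (div_nonneg hσ hr.le)] at hθdef
      have hΔ0 : Δ ≤ 0 := by
        by_contra! h
        linarith [mul_nonneg hρ h.le]
      subst hθdef
      rw [min_eq_right hΔ0, max_eq_left (neg_nonneg.mpr hK.le), sub_zero]
      rcases max_cases (ρ * (u + Δ) + σ) 0 with ⟨h, -⟩ | ⟨h, -⟩ <;> rw [h]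
      · exact (min_le_right _ _).trans (by linarith)
      · exact (min_le_left _ _).trans (by linarith)

/-- Deterministic end-to-end delay bound (Eq. (29)): `D 0 = A_0` is the
through-flow arrival, `D h` the departure of node `h` (arrival to node `h+1`),
each node offering for every `θ ≥ 0` the deterministic Δ-scheduler service curve.
Then `W_net(t) = inf{s ≥ 0 : D_H(t+s) ≥ A_0(t)}` is at most
`max_h max{σ_0/C_h, (σ_0 − U*_h)/(C_h − ρ_h)} + Σ_{h=1}^H θ*_h`, where
`θ*_h = min{σ_h/(C_h − ρ_h), [σ_h + ρ_h Δ^h]_+/C_h}` and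
`U*_h = [σ_h + ρ_h Δ^h]_−`. -/
theorem deterministic_delay_bound
    (H : ℕ) (hH : 1 ≤ H)
    (D : ℕ → ℝ → ℝ)
    (hD_zero : ∀ h, D h 0 = 0)
    (hD_mono : ∀ h, ∀ s t : ℝ, 0 ≤ s → s ≤ t → D h s ≤ D h t)
    (hD_nonneg : ∀ h, ∀ t : ℝ, 0 ≤ t → 0 ≤ D h t)
    (hD_le : ∀ h ∈ Finset.Icc 1 H, ∀ t : ℝ, 0 ≤ t → D h t ≤ D (h - 1) t)
    (C ρ σ Δ : ℕ → ℝ)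
    (hC : ∀ h ∈ Finset.Icc 1 H, 0 < C h)
    (hρ : ∀ h ∈ Finset.Icc 1 H, 0 ≤ ρ h)
    (hσ : ∀ h ∈ Finset.Icc 1 H, 0 ≤ σ h)
    (hρ0 : 0 ≤ ρ 0) (hσ0 : 0 ≤ σ 0)
    (hstab : ∀ h ∈ Finset.Icc 1 H, ρ 0 < C h - ρ h)
    (henv : ∀ s t : ℝ, 0 ≤ s → s ≤ t → D 0 t - D 0 s ≤ ρ 0 * (t - s) + σ 0)
    (hserv : ∀ h ∈ Finset.Icc 1 H, ∀ θ : ℝ, 0 ≤ θ → ∀ t : ℝ, 0 ≤ t →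
      (⨅ s : Icc (0:ℝ) t, (D (h - 1) ↑s + SdeltaDet (C h) (ρ h) (Δ h) θ (σ h) (t - ↑s)))
        ≤ D h t)
    (t : ℝ) (ht : 0 ≤ t) :
    sInf {s : ℝ | 0 ≤ s ∧ D 0 t ≤ D H (t + s)} ≤
      (Finset.Icc 1 H).sup' (Finset.nonempty_Icc.mpr hH) (fun h =>
        max (σ 0 / C h) ((σ 0 - max (-(σ h + ρ h * Δ h)) 0) / (C h - ρ h))) +
      ∑ h ∈ Finset.Icc 1 H,
        min (σ h / (C h - ρ h)) (max (σ h + ρ h * Δ h) 0 / C h) := by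
  set U : ℕ → ℝ := fun h => max (-(σ h + ρ h * Δ h)) 0 with hU
  set θ : ℕ → ℝ := fun h => min (σ h / (C h - ρ h)) (max (σ h + ρ h * Δ h) 0 / C h) with hθ
  set d := (Finset.Icc 1 H).sup' (Finset.nonempty_Icc.mpr hH) (fun h =>
    max (σ 0 / C h) ((σ 0 - U h) / (C h - ρ h))) with hd
  have hr : ∀ h ∈ Finset.Icc 1 H, 0 < C h - ρ h := fun h hh => hρ0.trans_lt (hstab h hh)
  have hθ0 : ∀ h ∈ Finset.Icc 1 H, 0 ≤ θ h := fun h hh =>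
    le_min (div_nonneg (hσ h hh) (hr h hh).le) (div_nonneg (le_max_right _ _) (hC h hh).le)
  have hd_le : ∀ h ∈ Finset.Icc 1 H, max (σ 0 / C h) ((σ 0 - U h) / (C h - ρ h)) ≤ d :=
    fun h hh => Finset.le_sup' (fun h => max (σ 0 / C h) ((σ 0 - U h) / (C h - ρ h))) hh
  have h1H : 1 ∈ Finset.Icc 1 H := Finset.mem_Icc.mpr ⟨le_rfl, hH⟩
  have hd0 : 0 ≤ d :=
    (div_nonneg hσ0 (hC 1 h1H).le).trans ((le_max_left _ _).trans (hd_le 1 h1H))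
  have hΘ0 : 0 ≤ ∑ h ∈ Finset.Icc 1 H, θ h := Finset.sum_nonneg hθ0
  classical
  let L : Finset (ℝ × ℝ) := (Finset.Icc 1 H).image (fun h => (C h, (0:ℝ))) ∪
    (Finset.Icc 1 H).image (fun h => (C h - ρ h, U h))
  have hLC : ∀ h ∈ Finset.Icc 1 H, (C h, (0:ℝ)) ∈ L := fun h hh =>
    Finset.mem_union_left _ (Finset.mem_image_of_mem (fun h => (C h, (0:ℝ))) hh)
  have hLr : ∀ h ∈ Finset.Icc 1 H, (C h - ρ h, U h) ∈ L := fun h hh =>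
    Finset.mem_union_right _ (Finset.mem_image_of_mem (fun h => (C h - ρ h, U h)) hh)
  have hL : L.Nonempty := ⟨_, hLC 1 h1H⟩
  have hLprop : ∀ p ∈ L, ρ 0 ≤ p.1 ∧ 0 ≤ p.2 ∧ σ 0 ≤ p.1 * d + p.2 := by
    intro p hp
    rcases Finset.mem_union.mp hp with hp | hp <;> obtain ⟨h, hh, rfl⟩ := Finset.mem_image.mp hp
    · have := (div_le_iff₀' (hC h hh)).mp ((le_max_left _ _).trans (hd_le h hh))
      exact ⟨by linarith [hstab h hh, hρ h hh], le_rfl, by simpa using this⟩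
    · have := (div_le_iff₀' (hr h hh)).mp ((le_max_right _ _).trans (hd_le h hh))
      exact ⟨(hstab h hh).le, le_max_right _ _, by simpa using this⟩
  refine csInf_le ⟨0, fun s hs => hs.1⟩ ⟨add_nonneg hd0 hΘ0, ?_⟩
  refine le_departure_of_forall_le (b := minAffine L hL) (θ := θ)
    (S := fun h u => SdeltaDet (C h) (ρ h) (Δ h) (θ h) (σ h) u)
    (fun x y => minAffine_mono hL fun p hp => hρ0.trans (hLprop p hp).1) ?_
    (fun x y => minAffine_add_le hL fun p hp => (hLprop p hp).2.1) ?_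
    (fun h hh => hserv h hh (θ h) (hθ0 h hh)) H le_rfl _ (by positivity) _ ?_
  · simpa using minAffine_le hL (hLC 1 h1H) 0
  · intro h hh u _
    refine le_trans (le_min ?_ ?_) (min_affine_le_SdeltaDet (hC h hh) (hρ h hh)
      (sub_pos.mp (hr h hh)) (hσ h hh))
    · simpa using minAffine_le hL (hLC h hh) (max (u - θ h) 0)
    · exact minAffine_le hL (hLr h hh) (max (u - θ h) 0)
  · intro s hs _
    set v := max (t + (d + ∑ h ∈ Finset.Icc 1 H, θ h) - s - ∑ h ∈ Finset.Icc 1 H, θ h) 0 with hv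
    obtain ⟨p, hp, hpv⟩ := exists_minAffine_eq hL v
    obtain ⟨hp1, hp2, hpd⟩ := hLprop p hp
    rw [hpv]
    rcases le_total s t with hst | hst
    · have h1 : t - s + d ≤ v := le_trans (by linarith) (le_max_left _ _)
      have h2 := mul_le_mul_of_nonneg_left h1 (hρ0.trans hp1)
      have h3 := mul_le_mul_of_nonneg_right hp1 (sub_nonneg.mpr hst)
      linarith [henv s t hs hst]
    · have h1 := mul_nonneg (hρ0.trans hp1) (le_max_right _ _ : 0 ≤ v)
      linarith [hD_mono 0 t s ht hst]
end
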